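/- (Main theorem) There is an absolute constant C such that: if f : 𝔽₂ⁿ → {0,1} satisfies ‖f‖_A ≤ M, then f = ∑_{j=1}^{L} ε_j 1_{H_j} for some L ≤ 2^{2^{CM⁴}}, signs ε_j ∈ {+1,−1}, and subgroups H_j ≤ 𝔽₂ⁿ. -/

import Mathlib

open scoped Classical
open Finset

noncomputable def ft {n : ℕ} (f : (Fin n → ZMod 2) → ℝ) (r : Fin n → ZMod 2) : ℝ :=
  (∑ x : Fin n → ZMod 2, f x * (-1 : ℝ) ^ (∑ i, r i * x i).val) /
    (Fintype.card (Fin n → ZMod 2))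

noncomputable def aNorm {n : ℕ} (f : (Fin n → ZMod 2) → ℝ) : ℝ := ∑ r : Fin n → ZMod 2, |ft f r|

section

variable {n : ℕ}

/-- The character of `𝔽₂ⁿ` attached to `r`. -/
noncomputable def walsh (r x : Fin n → ZMod 2) : ℝ := (-1 : ℝ) ^ (∑ i, r i * x i).val

lemma neg_one_pow_val_add (a b : ZMod 2) :
    (-1 : ℝ) ^ (a + b).val = (-1) ^ a.val * (-1) ^ b.val := by
  have key : ∀ a b : ZMod 2, (a + b).val % 2 = (a.val + b.val) % 2 := by decide
  rw [← pow_add, neg_one_pow_eq_pow_mod_two, key, ← neg_one_pow_eq_pow_mod_two]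

lemma walsh_comm (r x : Fin n → ZMod 2) : walsh r x = walsh x r := by
  simp [walsh, mul_comm]

lemma walsh_add_right (r x y : Fin n → ZMod 2) : walsh r (x + y) = walsh r x * walsh r y := by
  simp only [walsh, Pi.add_apply, mul_add, sum_add_distrib, neg_one_pow_val_add]

lemma walsh_add_left (r s x : Fin n → ZMod 2) : walsh (r + s) x = walsh r x * walsh s x := by
  rw [walsh_comm, walsh_add_right, walsh_comm x, walsh_comm x]

lemma walsh_zero_right (r : Fin n → ZMod 2) : walsh r 0 = 1 := by simp [walsh]

lemma walsh_eq_one_or (r x : Fin n → ZMod 2) : walsh r x = 1 ∨ walsh r x = -1 :=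
  neg_one_pow_eq_or ℝ _

lemma abs_walsh (r x : Fin n → ZMod 2) : |walsh r x| = 1 := by
  rcases walsh_eq_one_or r x with h | h <;> simp [h]

lemma walsh_mul_self (r x : Fin n → ZMod 2) : walsh r x * walsh r x = 1 := by
  rcases walsh_eq_one_or r x with h | h <;> simp [h]

lemma walsh_sum_right {ι : Type*} (r : Fin n → ZMod 2) (s : Finset ι) (a : ι → Fin n → ZMod 2) :
    walsh r (∑ i ∈ s, a i) = ∏ i ∈ s, walsh r (a i) := by
  induction s using Finset.induction_on with
  | empty => simp [walsh_zero_right]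
  | insert i s hi ih => rw [sum_insert hi, prod_insert hi, walsh_add_right, ih]

lemma add_self_zmod_two (x : Fin n → ZMod 2) : x + x = 0 :=
  funext fun i => CharTwo.add_self_eq_zero (x i)

/-- The trigonometric polynomial with coefficients `F`. -/
noncomputable def walshSum (F : (Fin n → ZMod 2) → ℝ) (x : Fin n → ZMod 2) : ℝ :=
  ∑ r, F r * walsh r x

lemma abs_walshSum_le (F : (Fin n → ZMod 2) → ℝ) (x : Fin n → ZMod 2) :
    |walshSum F x| ≤ ∑ r, |F r| := by
  refine (abs_sum_le_sum_abs _ _).trans (sum_le_sum fun r _ => ?_)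
  rw [abs_mul, abs_walsh, mul_one]

/-- The annihilator of `H` under the pairing given by `walsh`. -/
def perp (H : Submodule (ZMod 2) (Fin n → ZMod 2)) : Set (Fin n → ZMod 2) :=
  {r | ∀ h ∈ H, walsh r h = 1}

lemma add_mem_perp {H : Submodule (ZMod 2) (Fin n → ZMod 2)} {r s : Fin n → ZMod 2}
    (hr : r ∈ perp H) (hs : s ∈ perp H) : r + s ∈ perp H := fun h hh => by
  rw [walsh_add_left, hr h hh, hs h hh, one_mul]

lemma perp_anti {H K : Submodule (ZMod 2) (Fin n → ZMod 2)} (hHK : H ≤ K) : perp K ⊆ perp H :=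
  fun _ hr h hh => hr h (hHK hh)

/-- The elements of a subspace, as a finset. -/
noncomputable def elems (H : Submodule (ZMod 2) (Fin n → ZMod 2)) : Finset (Fin n → ZMod 2) :=
  univ.filter (· ∈ H)

lemma mem_elems {H : Submodule (ZMod 2) (Fin n → ZMod 2)} {x : Fin n → ZMod 2} :
    x ∈ elems H ↔ x ∈ H := by simp [elems]

lemma card_elems (H : Submodule (ZMod 2) (Fin n → ZMod 2)) :
    (elems H).card = 2 ^ Module.finrank (ZMod 2) H := by
  have h := Module.card_eq_pow_finrank (K := ZMod 2) (V := H)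
  rw [ZMod.card] at h
  rw [← h, elems, Fintype.card_subtype]

lemma sum_elems_add (H : Submodule (ZMod 2) (Fin n → ZMod 2)) {k : Fin n → ZMod 2} (hk : k ∈ H)
    (φ : (Fin n → ZMod 2) → ℝ) : ∑ h ∈ elems H, φ (h + k) = ∑ h ∈ elems H, φ h := by
  refine sum_nbij' (· + k) (· + k) ?_ ?_ ?_ ?_ ?_
  · intro h hh; exact mem_elems.2 (H.add_mem (mem_elems.1 hh) hk)
  · intro h hh; exact mem_elems.2 (H.add_mem (mem_elems.1 hh) hk)
  · intro h _; simp [add_assoc, add_self_zmod_two]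
  · intro h _; simp [add_assoc, add_self_zmod_two]
  · intro h _; rfl

lemma sum_walsh_of_notMem_perp {H : Submodule (ZMod 2) (Fin n → ZMod 2)} {t : Fin n → ZMod 2}
    (ht : t ∉ perp H) : ∑ h ∈ elems H, walsh t h = 0 := by
  obtain ⟨k, hk, hne⟩ : ∃ k ∈ H, walsh t k ≠ 1 := by
    by_contra! h
    exact ht h
  have h1 : walsh t k = -1 := (walsh_eq_one_or t k).resolve_left hne
  have h2 := sum_elems_add H hk (walsh t)
  simp only [walsh_add_right, h1, mul_neg, mul_one, sum_neg_distrib] at h2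
  linarith

lemma sum_walsh_of_mem_perp {H : Submodule (ZMod 2) (Fin n → ZMod 2)} {t : Fin n → ZMod 2}
    (ht : t ∈ perp H) : ∑ h ∈ elems H, walsh t h = (elems H).card := by
  rw [sum_congr rfl fun h hh => ht h (mem_elems.1 hh)]; simp

/-- The part of `H` on which the character `t` is trivial. -/
def cut (H : Submodule (ZMod 2) (Fin n → ZMod 2)) (t : Fin n → ZMod 2) :
    Submodule (ZMod 2) (Fin n → ZMod 2) :=
  H ⊓ LinearMap.ker (dotProductBilin (ZMod 2) (ZMod 2) t)

lemma walsh_eq_one_iff (t x : Fin n → ZMod 2) : walsh t x = 1 ↔ t ⬝ᵥ x = 0 := by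
  have key : ∀ a : ZMod 2, (-1 : ℝ) ^ a.val = 1 ↔ a = 0 := by
    intro a
    have ha : ∀ a : ZMod 2, a = 0 ∨ a = 1 := by decide
    rcases ha a with rfl | rfl
    · simp
    · norm_num [ZMod.val_one]
  exact key _

lemma mem_cut {H : Submodule (ZMod 2) (Fin n → ZMod 2)} {t x : Fin n → ZMod 2} :
    x ∈ cut H t ↔ x ∈ H ∧ walsh t x = 1 := by
  rw [walsh_eq_one_iff]; simp [cut]

lemma cut_le (H : Submodule (ZMod 2) (Fin n → ZMod 2)) (t : Fin n → ZMod 2) : cut H t ≤ H :=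
  inf_le_left

lemma finrank_cut_lt {H : Submodule (ZMod 2) (Fin n → ZMod 2)} {t : Fin n → ZMod 2}
    (ht : t ∉ perp H) : Module.finrank (ZMod 2) (cut H t) < Module.finrank (ZMod 2) H := by
  apply Submodule.finrank_lt_finrank_of_lt
  refine lt_of_le_of_ne (cut_le H t) fun h => ht fun x hx => ?_
  rw [← h] at hx
  exact (mem_cut.1 hx).2

lemma finrank_le_finrank_cut (H : Submodule (ZMod 2) (Fin n → ZMod 2)) (t : Fin n → ZMod 2) :
    Module.finrank (ZMod 2) H ≤ Module.finrank (ZMod 2) (cut H t) + 1 := by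
  set φ := dotProductBilin (ZMod 2) (ZMod 2) t with hφ
  have h1 := Submodule.finrank_sup_add_finrank_inf_eq H (LinearMap.ker φ)
  have h2 := LinearMap.finrank_range_add_finrank_ker φ
  have h3 : Module.finrank (ZMod 2) (LinearMap.range φ) ≤ 1 :=
    (Submodule.finrank_le _).trans (by simp)
  have h4 := Submodule.finrank_le (H ⊔ LinearMap.ker φ)
  have h5 : cut H t = H ⊓ LinearMap.ker φ := rfl
  rw [h5]
  omega

lemma walshSum_ft (f : (Fin n → ZMod 2) → ℝ) (x : Fin n → ZMod 2) : walshSum (ft f) x = f x := by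
  have horth : ∀ y : Fin n → ZMod 2, ∑ r : Fin n → ZMod 2, walsh r (y + x) =
      if y = x then (Fintype.card (Fin n → ZMod 2) : ℝ) else 0 := by
    intro y
    have htop : elems (⊤ : Submodule (ZMod 2) (Fin n → ZMod 2)) = univ := by simp [elems]
    split_ifs with hyx
    · subst hyx; simp [add_self_zmod_two, walsh_zero_right]
    · rw [← htop]
      simp_rw [fun r => walsh_comm r (y + x)]
      refine sum_walsh_of_notMem_perp fun h => hyx ?_
      have hz : ∀ w, (y + x) ⬝ᵥ w = 0 := fun w => (walsh_eq_one_iff _ _).1 (h w trivial)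
      have : y + x = 0 := dotProduct_eq_zero _ hz
      calc y = y + (x + x) := by rw [add_self_zmod_two, add_zero]
        _ = x := by rw [← add_assoc, this, zero_add]
  calc walshSum (ft f) x
      = ∑ r, (∑ y, f y * walsh r (y + x)) / Fintype.card (Fin n → ZMod 2) := by
        refine sum_congr rfl fun r _ => ?_
        rw [ft, div_mul_eq_mul_div, sum_mul]
        congr 1
        exact sum_congr rfl fun y _ => by rw [walsh_add_right, ← mul_assoc]; rfl
    _ = (∑ y, f y * ∑ r, walsh r (y + x)) / Fintype.card (Fin n → ZMod 2) := by
        rw [← sum_div, sum_comm]; simp_rw [mul_sum]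
    _ = f x := by
        simp_rw [horth]
        simp

lemma norm_one_add_I_mul_le (y : ℝ) : ‖(1 + Complex.I * y : ℂ)‖ ≤ Real.exp (y ^ 2 / 2) := by
  have h1 : ‖(1 + Complex.I * y : ℂ)‖ ^ 2 = 1 + y ^ 2 := by
    rw [← Complex.normSq_eq_norm_sq, Complex.normSq_apply]
    simp; ring
  have h2 : 1 + y ^ 2 ≤ Real.exp (y ^ 2 / 2) ^ 2 := by
    rw [← Real.exp_nat_mul]
    have h3 : ((2 : ℕ) : ℝ) * (y ^ 2 / 2) = y ^ 2 := by push_cast; ring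
    rw [h3]
    linarith [Real.add_one_le_exp (y ^ 2)]
  exact (pow_le_pow_iff_left₀ (norm_nonneg _) (Real.exp_pos _).le two_ne_zero).1 (h1.trans_le h2)

lemma walshSum_sum {ι : Type*} (F : (Fin n → ZMod 2) → ℝ) (S : Finset ι)
    (a : ι → Fin n → ZMod 2) :
    walshSum F (∑ i ∈ S, a i) = ∑ r, F r * ∏ i ∈ S, walsh r (a i) := by
  simp [walshSum, walsh_sum_right]

/-- Expansion of a function of small spectral norm against a Riesz product. -/
lemma riesz_product_expansion {m : ℕ} (F : (Fin n → ZMod 2) → ℝ) (a : Fin m → Fin n → ZMod 2)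
    (c : Fin m → ℝ) :
    ∑ r, (F r : ℂ) * ∏ i, (1 + Complex.I * ((c i * walsh r (a i) : ℝ) : ℂ)) =
      ∑ S : Finset (Fin m),
        Complex.I ^ #S * (((∏ i ∈ S, c i) * walshSum F (∑ i ∈ S, a i) : ℝ) : ℂ) := by
  simp_rw [prod_one_add, powerset_univ, mul_sum]
  rw [sum_comm]
  refine sum_congr rfl fun S _ => ?_
  rw [walshSum_sum]
  push_cast
  rw [mul_sum, mul_sum]
  refine sum_congr rfl fun r _ => ?_
  rw [prod_mul_distrib, prod_mul_distrib, prod_const]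
  ring

lemma norm_riesz_le {m : ℕ} (F : (Fin n → ZMod 2) → ℝ) (a : Fin m → Fin n → ZMod 2)
    (c : Fin m → ℝ) :
    ‖∑ r, (F r : ℂ) * ∏ i, (1 + Complex.I * ((c i * walsh r (a i) : ℝ) : ℂ))‖ ≤
      (∑ r, |F r|) * Real.exp ((∑ i, c i ^ 2) / 2) := by
  rw [sum_mul]
  refine (norm_sum_le _ _).trans (sum_le_sum fun r _ => ?_)
  rw [norm_mul, norm_prod, Complex.norm_real, Real.norm_eq_abs]
  gcongr
  rw [sum_div, Real.exp_sum]
  refine prod_le_prod (fun _ _ => norm_nonneg _) fun i _ => ?_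
  refine (norm_one_add_I_mul_le _).trans_eq ?_
  rw [mul_pow, pow_two (walsh r (a i)), walsh_mul_self, mul_one]

/-- A function of spectral norm at most `M` that is very close to `0` off `A` and bounded away
from `0` on `A` must be large at some non-trivial subset sum of any long sequence in `A`. -/
lemma exists_subset_sum_mem {M : ℕ} (hM : 1 ≤ M) {F : (Fin n → ZMod 2) → ℝ}
    (hF : ∑ r, |F r| ≤ M) {ε : ℝ} (hε0 : 0 ≤ ε) (hε : ε ≤ (1 / 1024) ^ M)
    {A : Finset (Fin n → ZMod 2)} (hA : ∀ x ∈ A, 1 - ε ≤ |walshSum F x|)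
    (hA' : ∀ x ∉ A, |walshSum F x| ≤ ε) (a : Fin (16 * M ^ 2) → Fin n → ZMod 2)
    (ha : ∀ i, a i ∈ A) : ∃ S : Finset (Fin (16 * M ^ 2)), 2 ≤ #S ∧ ∑ i ∈ S, a i ∈ A := by
  by_contra! hcon
  have hM' : (1 : ℝ) ≤ M := by exact_mod_cast hM
  set τ : ℝ := 1 / (4 * M) with hτ
  have hτ0 : 0 < τ := by positivity
  have hsign : ∀ y : ℝ, ∃ s : ℝ, |s| = 1 ∧ s * y = |y| := by
    intro y
    rcases le_total 0 y with h | h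
    · exact ⟨1, by simp, by simp [abs_of_nonneg h]⟩
    · exact ⟨-1, by simp, by simp [abs_of_nonpos h]⟩
  choose s hs hs' using fun i => hsign (walshSum F (a i))
  set c : Fin (16 * M ^ 2) → ℝ := fun i => τ * s i with hc
  have hexp := riesz_product_expansion F a c
  have hnorm := norm_riesz_le F a c
  have hsq : ∑ i, c i ^ 2 = 1 := by
    have : ∀ i, c i ^ 2 = τ ^ 2 := fun i => by
      rw [hc]; simp only; rw [mul_pow, ← sq_abs (s i), hs i]; ring
    simp only [this, sum_const, card_univ, Fintype.card_fin, nsmul_eq_mul]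
    rw [hτ]; push_cast; field_simp; norm_num
  have habs : ∀ S : Finset (Fin (16 * M ^ 2)), |∏ i ∈ S, c i| = τ ^ #S := by
    intro S
    rw [abs_prod, prod_congr rfl (g := fun _ => τ), prod_const]
    intro i _
    rw [hc]; simp only; rw [abs_mul, hs i, abs_of_pos hτ0, mul_one]
  have hlow : ∀ S : Finset (Fin (16 * M ^ 2)),
      (if #S = 1 then τ * (1 - ε) else 0) - ε * τ ^ #S ≤
      (Complex.I ^ #S * (((∏ i ∈ S, c i) * walshSum F (∑ i ∈ S, a i) : ℝ) : ℂ)).im := by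
    intro S
    rcases lt_trichotomy (#S) 1 with h | h | h
    · have h0 : #S = 0 := by omega
      simp only [h0, pow_zero, one_mul, Complex.ofReal_im]
      simpa using hε0
    · obtain ⟨i, rfl⟩ := card_eq_one.1 h
      have h1 := hA _ (ha i)
      have h2 : c i * walshSum F (a i) = τ * |walshSum F (a i)| := by
        rw [hc]; simp only; rw [mul_assoc, hs']
      simp only [card_singleton, pow_one, if_true, prod_singleton, sum_singleton, h2]
      rw [Complex.im_mul_ofReal, Complex.I_im, one_mul]
      nlinarith [mul_le_mul_of_nonneg_left h1 hτ0.le, mul_nonneg hε0 hτ0.le]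
    · rw [if_neg (by omega), zero_sub, Complex.im_mul_ofReal]
      have h1 : |(Complex.I ^ #S).im| ≤ 1 := by
        refine (Complex.abs_im_le_norm _).trans ?_
        simp
      have h2 := hA' _ (hcon S h)
      refine (abs_le.1 ?_).1
      rw [abs_mul, abs_mul, habs]
      calc _ ≤ 1 * (τ ^ #S * ε) := by gcongr
        _ = _ := by ring
  have hpow : ∑ S : Finset (Fin (16 * M ^ 2)), τ ^ #S ≤ 81 ^ M := by
    have h1 : ∑ S : Finset (Fin (16 * M ^ 2)), τ ^ #S = (1 + τ) ^ (16 * M ^ 2) := by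
      have := prod_one_add (s := (univ : Finset (Fin (16 * M ^ 2)))) (f := fun _ => τ)
      simp only [prod_const, card_univ, Fintype.card_fin, powerset_univ] at this
      exact this.symm
    rw [h1]
    calc (1 + τ) ^ (16 * M ^ 2) ≤ (Real.exp τ) ^ (16 * M ^ 2) := by
          gcongr
          linarith [Real.add_one_le_exp τ]
      _ = (Real.exp 1 ^ 4) ^ M := by
          rw [← Real.exp_nat_mul, ← Real.exp_nat_mul, ← Real.exp_nat_mul, hτ]
          congr 1
          push_cast; field_simp; norm_num
      _ ≤ (3 ^ 4) ^ M := by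
          gcongr
          linarith [Real.exp_one_lt_d9]
      _ = 81 ^ M := by norm_num
  have hε1 : ε * ∑ S : Finset (Fin (16 * M ^ 2)), τ ^ #S ≤ 1 := by
    calc _ ≤ (1 / 1024) ^ M * (81 : ℝ) ^ M := by
          gcongr
      _ = (81 / 1024 : ℝ) ^ M := by rw [← mul_pow]; norm_num
      _ ≤ 1 := pow_le_one₀ (by norm_num) (by norm_num)
  have hε2 : ε ≤ 1 / 1024 := hε.trans (pow_le_of_le_one (by norm_num) (by norm_num) (by omega))
  have hcount : ∑ S : Finset (Fin (16 * M ^ 2)), (if #S = 1 then τ * (1 - ε) else 0) =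
      4 * M * (1 - ε) := by
    rw [← sum_filter, sum_const, nsmul_eq_mul]
    have : (univ.filter fun S : Finset (Fin (16 * M ^ 2)) => #S = 1).card = 16 * M ^ 2 := by
      have h := card_powersetCard 1 (univ : Finset (Fin (16 * M ^ 2)))
      rw [← powerset_univ, ← powersetCard_eq_filter, h]
      simp
    rw [this, hτ]; push_cast; field_simp; ring
  have hfin : 4 * M * (1 - ε) - 1 ≤ M * 2 := by
    calc 4 * M * (1 - ε) - 1
        ≤ ∑ S : Finset (Fin (16 * M ^ 2)),
          ((if #S = 1 then τ * (1 - ε) else 0) - ε * τ ^ #S) := by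
          rw [sum_sub_distrib, hcount, ← mul_sum]; linarith
      _ ≤ _ := sum_le_sum fun S _ => hlow S
      _ = (∑ r, (F r : ℂ) * ∏ i, (1 + Complex.I * ((c i * walsh r (a i) : ℝ) : ℂ))).im := by
          rw [← Complex.im_sum, hexp]
      _ ≤ (∑ r, |F r|) * Real.exp ((∑ i, c i ^ 2) / 2) :=
          (le_abs_self _).trans ((Complex.abs_im_le_norm _).trans hnorm)
      _ ≤ M * 2 := by
          rw [hsq]
          gcongr
          have h1 : Real.exp (1 / 2) ^ 2 = Real.exp 1 := by
            rw [← Real.exp_nat_mul]; norm_num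
          have h2 := Real.exp_one_lt_d9
          nlinarith [Real.exp_pos (1 / 2 : ℝ)]
  nlinarith

/-- Pigeonholing: if every long sequence in `A` has a non-trivial subset sum in `A`, then many
pair sums of `A` land in a single translate of `A`. -/
lemma exists_translate_popular {m : ℕ} {A : Finset (Fin n → ZMod 2)} (hA : A.Nonempty)
    (h : ∀ a : Fin m → Fin n → ZMod 2, (∀ i, a i ∈ A) →
      ∃ S : Finset (Fin m), 2 ≤ #S ∧ ∑ i ∈ S, a i ∈ A) :
    ∃ t : Fin n → ZMod 2,
      #A ^ 2 ≤ 2 ^ m * #((A ×ˢ A).filter fun p => p.1 + p.2 + t ∈ A) := by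
  set T := Fintype.piFinset fun _ : Fin m => A with hT
  have hTcard : #T = #A ^ m := by simp [hT]
  obtain ⟨S, hS⟩ : ∃ S : Finset (Fin m),
      #A ^ m ≤ 2 ^ m * #(T.filter fun a => 2 ≤ #S ∧ ∑ i ∈ S, a i ∈ A) := by
    by_contra! hcon
    have hsub : T ⊆ (univ : Finset (Finset (Fin m))).biUnion
        fun S => T.filter fun a => 2 ≤ #S ∧ ∑ i ∈ S, a i ∈ A := by
      intro a ha
      obtain ⟨S, hS⟩ := h a (by simpa [hT] using ha)
      exact mem_biUnion.2 ⟨S, mem_univ _, mem_filter.2 ⟨ha, hS⟩⟩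
    have h1 : 2 ^ m * #T ≤ ∑ S : Finset (Fin m),
        2 ^ m * #(T.filter fun a => 2 ≤ #S ∧ ∑ i ∈ S, a i ∈ A) := by
      rw [← mul_sum]
      exact Nat.mul_le_mul_left _ ((card_le_card hsub).trans card_biUnion_le)
    have h2 := sum_lt_sum_of_nonempty (s := (univ : Finset (Finset (Fin m))))
      univ_nonempty fun S _ => hcon S
    simp only [sum_const, card_univ, Fintype.card_finset, Fintype.card_fin, smul_eq_mul] at h2
    rw [hTcard] at h1
    omega
  set U := T.filter fun a => 2 ≤ #S ∧ ∑ i ∈ S, a i ∈ A with hU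
  have hUne : U.Nonempty := by
    rw [nonempty_iff_ne_empty]
    intro h0
    rw [h0, card_empty, mul_zero] at hS
    exact absurd hS (not_le.2 (pow_pos hA.card_pos _))
  obtain ⟨a₀, ha₀⟩ := hUne
  have hS2 : 2 ≤ #S := (mem_filter.1 ha₀).2.1
  obtain ⟨i, hi, j, hj, hij⟩ := one_lt_card.1 hS2
  set R := Fintype.piFinset fun _ : {k : Fin m // k ≠ i ∧ k ≠ j} => A with hR
  have hRcard : #R * #A ^ 2 = #A ^ m := by
    have hc : Fintype.card {k : Fin m // k ≠ i ∧ k ≠ j} + 2 = m := by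
      have : (univ.filter fun k : Fin m => k ≠ i ∧ k ≠ j) = univ \ {i, j} := by
        ext k; simp
      rw [Fintype.card_subtype, this, card_sdiff_of_subset (subset_univ _), card_pair hij]
      have : 2 ≤ m := hS2.trans (by simpa using card_le_univ S)
      simp; omega
    have hRc : #R = #A ^ Fintype.card {k : Fin m // k ≠ i ∧ k ≠ j} := by simp [hR]
    rw [hRc, ← pow_add, hc]
  have hmaps : ∀ a ∈ U, (fun k : {k : Fin m // k ≠ i ∧ k ≠ j} => a k) ∈ R := by
    intro a ha
    have := (mem_filter.1 ha).1
    simp only [hT, Fintype.mem_piFinset] at this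
    simp only [hR, Fintype.mem_piFinset]
    exact fun k => this k
  have hRne : R.Nonempty := ⟨_, hmaps a₀ ha₀⟩
  obtain ⟨b, -, hb⟩ : ∃ b ∈ R, #A ^ 2 ≤ 2 ^ m *
      #(U.filter fun a => (fun k : {k : Fin m // k ≠ i ∧ k ≠ j} => a k) = b) := by
    by_contra! hcon
    have h1 := sum_lt_sum_of_nonempty hRne hcon
    rw [← mul_sum, ← card_eq_sum_card_fiberwise hmaps, sum_const, smul_eq_mul, hRcard] at h1
    omega
  set t := ∑ k ∈ (S.erase i).erase j, (if hk : k ≠ i ∧ k ≠ j then b ⟨k, hk⟩ else 0) with ht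
  refine ⟨t, hb.trans (Nat.mul_le_mul_left _ ?_)⟩
  refine card_le_card_of_injOn (fun a => (a i, a j)) ?_ ?_
  · intro a ha
    simp only [coe_filter, Set.mem_ofPred_eq, hU, mem_filter, hT, Fintype.mem_piFinset] at ha
    obtain ⟨⟨haA, -, hsum⟩, hab⟩ := ha
    simp only [coe_filter, Set.mem_ofPred_eq, mem_product]
    refine ⟨⟨haA i, haA j⟩, ?_⟩
    have : t = ∑ k ∈ (S.erase i).erase j, a k := by
      refine sum_congr rfl fun k hk => ?_
      have hk' : k ≠ i ∧ k ≠ j := by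
        simp only [mem_erase] at hk; exact ⟨hk.2.1, hk.1⟩
      rw [dif_pos hk', ← hab]
    rw [this, add_assoc, add_sum_erase _ _ (mem_erase.2 ⟨hij.symm, hj⟩), add_sum_erase _ _ hi]
    exact hsum
  · intro a ha a' ha' haa
    simp only [coe_filter, Set.mem_ofPred_eq] at ha ha'
    simp only [Prod.mk.injEq] at haa
    funext k
    by_cases hk : k ≠ i ∧ k ≠ j
    · exact congrFun (ha.2.trans ha'.2.symm) ⟨k, hk⟩
    · by_cases hki : k = i
      · rw [hki]; exact haa.1
      · have : k = j := by tauto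
        rw [this]; exact haa.2

section BalogSzemerediGowers

open scoped Pointwise

/-- The elements of `A` whose sum with `x` lies in `P`. -/
noncomputable def nbhd (A P : Finset (Fin n → ZMod 2)) (x : Fin n → ZMod 2) :
    Finset (Fin n → ZMod 2) := A.filter fun w => x + w ∈ P

lemma mem_nbhd_comm {A P : Finset (Fin n → ZMod 2)} {x v : Fin n → ZMod 2} (hx : x ∈ A)
    (hv : v ∈ A) : x ∈ nbhd A P v ↔ v ∈ nbhd A P x := by
  simp [nbhd, hx, hv, add_comm]

/-- Dependent random choice in the Cayley graph on `A` generated by `P`. -/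
lemma exists_nbhd_few_bad_pairs {A P : Finset (Fin n → ZMod 2)} (hA : A.Nonempty) {η : ℝ}
    (hη : 0 < η)
    (h : η * (#A : ℝ) ^ 2 ≤ #((A ×ˢ A).filter fun p => p.1 + p.2 ∈ P)) :
    ∃ v ∈ A, η ^ 2 * (#A : ℝ) ^ 2 / 2 +
      16 * #((nbhd A P v ×ˢ nbhd A P v).filter fun p =>
        (#(nbhd A P p.1 ∩ nbhd A P p.2) : ℝ) < η ^ 2 / 32 * #A) ≤ (#(nbhd A P v) : ℝ) ^ 2 := by
  set a : ℝ := (#A : ℝ) with ha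
  have ha0 : 0 < a := Nat.cast_pos.2 hA.card_pos
  set bad : (Fin n → ZMod 2) × (Fin n → ZMod 2) → Prop :=
    fun p => (#(nbhd A P p.1 ∩ nbhd A P p.2) : ℝ) < η ^ 2 / 32 * a with hbad
  have hedges : η * a ^ 2 ≤ ∑ v ∈ A, (#(nbhd A P v) : ℝ) := by
    refine h.trans_eq ?_
    rw [card_filter, sum_product]
    push_cast
    refine sum_congr rfl fun v _ => ?_
    simp [nbhd, sum_boole]
  have hsq : η ^ 2 * a ^ 3 ≤ ∑ v ∈ A, (#(nbhd A P v) : ℝ) ^ 2 := by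
    have h1 := sq_sum_le_card_mul_sum_sq (s := A) (f := fun v => (#(nbhd A P v) : ℝ))
    have h2 : (η * a ^ 2) ^ 2 ≤ a * ∑ v ∈ A, (#(nbhd A P v) : ℝ) ^ 2 :=
      (pow_le_pow_left₀ (by positivity) hedges 2).trans h1
    refine le_of_mul_le_mul_left ?_ ha0
    linarith
  have hbadsum : ∑ v ∈ A, (#((nbhd A P v ×ˢ nbhd A P v).filter bad) : ℝ) ≤
      η ^ 2 / 32 * a ^ 3 := by
    have h1 := sum_card_bipartiteAbove_eq_sum_card_bipartiteBelow
      (s := A) (t := (A ×ˢ A).filter bad)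
      (fun v p => p.1 ∈ nbhd A P v ∧ p.2 ∈ nbhd A P v)
    have h2 : ∀ v ∈ A, (nbhd A P v ×ˢ nbhd A P v).filter bad =
        bipartiteAbove (fun v p => p.1 ∈ nbhd A P v ∧ p.2 ∈ nbhd A P v)
          ((A ×ˢ A).filter bad) v := by
      intro v _
      ext p
      simp only [bipartiteAbove, mem_filter, mem_product]
      have : ∀ x, x ∈ nbhd A P v → x ∈ A := fun x hx => (mem_filter.1 hx).1
      constructor
      · rintro ⟨⟨h3, h4⟩, h5⟩; exact ⟨⟨⟨this _ h3, this _ h4⟩, h5⟩, h3, h4⟩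
      · rintro ⟨⟨_, h5⟩, h3, h4⟩; exact ⟨⟨h3, h4⟩, h5⟩
    have h3 : ∀ p ∈ (A ×ˢ A).filter bad,
        (#(bipartiteBelow (fun v p => p.1 ∈ nbhd A P v ∧ p.2 ∈ nbhd A P v) A p) : ℝ) ≤
          η ^ 2 / 32 * a := by
      intro p hp
      simp only [mem_filter, mem_product] at hp
      refine le_trans ?_ hp.2.le
      gcongr
      intro v hv
      simp only [bipartiteBelow, mem_filter] at hv
      exact mem_inter.2 ⟨(mem_nbhd_comm hp.1.1 hv.1).1 hv.2.1, (mem_nbhd_comm hp.1.2 hv.1).1 hv.2.2⟩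
    calc ∑ v ∈ A, (#((nbhd A P v ×ˢ nbhd A P v).filter bad) : ℝ)
        = ∑ p ∈ (A ×ˢ A).filter bad,
          (#(bipartiteBelow (fun v p => p.1 ∈ nbhd A P v ∧ p.2 ∈ nbhd A P v) A p) : ℝ) := by
          rw [sum_congr rfl fun v hv => by rw [h2 v hv]]
          exact_mod_cast h1
      _ ≤ ∑ p ∈ (A ×ˢ A).filter bad, η ^ 2 / 32 * a := sum_le_sum h3
      _ = #((A ×ˢ A).filter bad) * (η ^ 2 / 32 * a) := by simp
      _ ≤ (a * a) * (η ^ 2 / 32 * a) := by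
          gcongr
          exact (Nat.cast_le.2 ((card_filter_le _ _).trans_eq (card_product _ _))).trans_eq
            (Nat.cast_mul _ _)
      _ = η ^ 2 / 32 * a ^ 3 := by ring
  refine exists_le_of_sum_le hA ?_
  rw [sum_add_distrib, ← mul_sum, sum_const, nsmul_eq_mul, ← ha]
  linarith

lemma card_mul_le_of_quadruples {D P : Finset (Fin n → ZMod 2)} {c : ℝ}
    (h : ∀ d ∈ D, c ≤ #((P ×ˢ P ×ˢ P ×ˢ P).filter
      fun p => p.1 + p.2.1 + p.2.2.1 + p.2.2.2 = d)) : #D * c ≤ (#P : ℝ) ^ 4 := by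
  calc (#D * c : ℝ) = ∑ _d ∈ D, c := by simp
    _ ≤ ∑ d ∈ D, (#((P ×ˢ P ×ˢ P ×ˢ P).filter
      fun p => p.1 + p.2.1 + p.2.2.1 + p.2.2.2 = d) : ℝ) := sum_le_sum h
    _ ≤ #(P ×ˢ P ×ˢ P ×ˢ P) := by
      rw [← Nat.cast_sum, ← card_biUnion]
      · gcongr
        exact biUnion_subset.2 fun d _ => filter_subset _ _
      · intro d _ d' _ hdd
        exact disjoint_filter.2 fun p _ h1 h2 => hdd (h1.symm.trans h2)
    _ = (#P : ℝ) ^ 4 := by simp only [card_product]; push_cast; ring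

/-- The Balog–Szemerédi–Gowers theorem over `𝔽₂`. -/
lemma balog_szemeredi_gowers {A P : Finset (Fin n → ZMod 2)} (hA : A.Nonempty) (hP : #P ≤ #A)
    {T : ℕ} (hT : 1 ≤ T)
    (h : #A ^ 2 ≤ T * #((A ×ˢ A).filter fun p => p.1 + p.2 ∈ P)) :
    ∃ B ⊆ A, #A ≤ 3 * T * #B ∧ #(B + B) ≤ 12288 * T ^ 6 * #B := by
  have hT0 : (0 : ℝ) < T := by exact_mod_cast hT
  set η : ℝ := 1 / T with hη
  have hη0 : 0 < η := by positivity
  set a : ℝ := (#A : ℝ) with ha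
  have ha0 : 0 < a := Nat.cast_pos.2 hA.card_pos
  have h' : η * a ^ 2 ≤ #((A ×ˢ A).filter fun p => p.1 + p.2 ∈ P) := by
    rw [hη, one_div, inv_mul_le_iff₀ hT0, ha]
    exact_mod_cast h
  obtain ⟨v, -, hv⟩ := exists_nbhd_few_bad_pairs hA hη0 h'
  set A' := nbhd A P v with hA'
  set bad : (Fin n → ZMod 2) → (Fin n → ZMod 2) → Prop :=
    fun x y => (#(nbhd A P x ∩ nbhd A P y) : ℝ) < η ^ 2 / 32 * a with hbad
  set a' : ℝ := (#A' : ℝ) with ha'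
  set N : ℝ := (#((A' ×ˢ A').filter fun p => bad p.1 p.2) : ℝ) with hN
  have hv' : η ^ 2 * a ^ 2 / 2 + 16 * N ≤ a' ^ 2 := hv
  have hN0 : 0 ≤ N := by positivity
  have ha'0 : 0 ≤ a' := by positivity
  have ha'1 : η * a / 2 ≤ a' := by
    refine (pow_le_pow_iff_left₀ (by positivity) ha'0 two_ne_zero).1 ?_
    nlinarith [mul_pos hη0 ha0]
  have ha'2 : 0 < a' := lt_of_lt_of_le (by positivity) ha'1
  set B := A'.filter fun x => 4 * (#(A'.filter (bad x)) : ℝ) ≤ a' with hB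
  have hBA : B ⊆ A := (filter_subset _ _).trans (filter_subset _ _)
  have hBcard : 3 / 4 * a' ≤ #B := by
    have h1 : N = ∑ x ∈ A', (#(A'.filter (bad x)) : ℝ) := by
      rw [hN, card_filter, sum_product]
      push_cast
      exact sum_congr rfl fun x _ => by simp [sum_boole]
    have h2 : (#(A'.filter fun x => ¬ 4 * (#(A'.filter (bad x)) : ℝ) ≤ a') : ℝ) * (a' / 4) ≤ N := by
      rw [h1, ← nsmul_eq_mul]
      refine (card_nsmul_le_sum _ _ _ ?_).trans
        (sum_le_sum_of_subset_of_nonneg (filter_subset _ _) fun _ _ _ => by positivity)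
      intro x hx
      have := (mem_filter.1 hx).2
      linarith
    have h3 : (#B : ℝ) + #(A'.filter fun x => ¬ 4 * (#(A'.filter (bad x)) : ℝ) ≤ a') = a' := by
      have := card_filter_add_card_filter_not (s := A')
        (fun x => 4 * (#(A'.filter (bad x)) : ℝ) ≤ a')
      exact (Nat.cast_add _ _).symm.trans (congrArg (Nat.cast (R := ℝ)) this)
    have h4 : N ≤ a' ^ 2 / 16 := by nlinarith [mul_pos hη0 ha0]
    nlinarith
  have hAB : a ≤ 8 / 3 * T * #B := by
    have : a = T * (η * a) := by rw [hη]; field_simp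
    rw [this]
    nlinarith
  have hsum : ∀ d ∈ B + B, η ^ 5 / 4096 * a ^ 3 ≤ #((P ×ˢ P ×ˢ P ×ˢ P).filter
      fun p => p.1 + p.2.1 + p.2.2.1 + p.2.2.2 = d) := by
    intro d hd
    obtain ⟨x, hx, y, hy, rfl⟩ := mem_add.1 hd
    have hx2 := (mem_filter.1 hx).2
    have hy2 := (mem_filter.1 hy).2
    set Z := A'.filter fun z => ¬ bad x z ∧ ¬ bad y z with hZ
    have hZcard : a' / 2 ≤ #Z := by
      have hsub : A' ⊆ Z ∪ (A'.filter (bad x) ∪ A'.filter (bad y)) := by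
        intro z hz
        simp only [hZ, mem_union, mem_filter, hz, true_and]
        tauto
      have h1 : a' ≤ #Z + (#(A'.filter (bad x)) + #(A'.filter (bad y)) : ℝ) := by
        rw [ha']
        exact_mod_cast (card_le_card hsub).trans
          ((card_union_le _ _).trans (Nat.add_le_add_left (card_union_le _ _) _))
      linarith
    set Q := Z.sigma fun z => (nbhd A P x ∩ nbhd A P z) ×ˢ (nbhd A P y ∩ nbhd A P z) with hQ
    have hQcard : η ^ 5 / 4096 * a ^ 3 ≤ #Q := by
      have h1 : ∀ z ∈ Z, (η ^ 2 / 32 * a) ^ 2 ≤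
          (#((nbhd A P x ∩ nbhd A P z) ×ˢ (nbhd A P y ∩ nbhd A P z)) : ℝ) := by
        intro z hz
        have hz2 := (mem_filter.1 hz).2
        simp only [hbad, not_lt] at hz2
        rw [card_product, pow_two]
        push_cast
        exact mul_le_mul hz2.1 hz2.2 (by positivity) (by positivity)
      rw [hQ, card_sigma]
      push_cast
      refine le_trans ?_ (card_nsmul_le_sum _ _ _ h1)
      rw [nsmul_eq_mul]
      calc η ^ 5 / 4096 * a ^ 3 = (η * a / 2 / 2) * (η ^ 2 / 32 * a) ^ 2 := by ring
        _ ≤ #Z * (η ^ 2 / 32 * a) ^ 2 := by gcongr; linarith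
    refine hQcard.trans ?_
    norm_cast
    refine card_le_card_of_injOn
      (fun q => (x + q.2.1, q.1 + q.2.1, q.1 + q.2.2, y + q.2.2)) ?_ ?_
    · rintro ⟨z, w, w'⟩ hq
      simp only [hQ, coe_sigma, Set.mem_sigma_iff, mem_coe, mem_product, mem_inter, nbhd,
        mem_filter] at hq
      obtain ⟨-, ⟨⟨-, h1⟩, -, h2⟩, ⟨-, h3⟩, -, h4⟩ := hq
      simp only [coe_filter, Set.mem_ofPred_eq, mem_product]
      refine ⟨⟨h1, h2, h4, h3⟩, ?_⟩
      have e : x + w + (z + w) + (z + w') + (y + w') =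
        x + y + (w + w) + (z + z) + (w' + w') := by abel
      rw [e]
      simp [add_self_zmod_two]
    · rintro ⟨z, w, w'⟩ - ⟨z₁, w₁, w₁'⟩ - he
      simp only [Prod.mk.injEq, add_right_inj] at he
      obtain ⟨rfl, h2, -, rfl⟩ := he
      have := add_right_cancel h2
      subst this
      rfl
  have hfin := card_mul_le_of_quadruples hsum
  refine ⟨B, hBA, ?_, ?_⟩
  · have : (#A : ℝ) ≤ 3 * T * #B := by
      rw [← ha]
      refine hAB.trans ?_
      gcongr
      norm_num
    exact_mod_cast this
  · have hP' : (#P : ℝ) ≤ a := Nat.cast_le.2 hP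
    have h1 : (#(B + B) : ℝ) * (η ^ 5 / 4096 * a ^ 3) ≤ a ^ 4 :=
      hfin.trans (pow_le_pow_left₀ (by positivity) hP' 4)
    have h2 : (#(B + B) : ℝ) ≤ 4096 * T ^ 5 * a := by
      have e : (#(B + B) : ℝ) * (η ^ 5 / 4096 * a ^ 3) * (4096 * T ^ 5) = #(B + B) * a ^ 3 := by
        rw [hη]; field_simp
      have h3 := mul_le_mul_of_nonneg_right h1 (by positivity : (0 : ℝ) ≤ 4096 * T ^ 5)
      rw [e] at h3
      refine le_of_mul_le_mul_right ?_ (pow_pos ha0 3)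
      linarith
    have : (#(B + B) : ℝ) ≤ 12288 * T ^ 6 * #B := by
      calc (#(B + B) : ℝ) ≤ 4096 * T ^ 5 * (8 / 3 * T * #B) := h2.trans (by gcongr)
        _ = 4096 * (8 / 3) * (T ^ 6 * #B) := by ring
        _ ≤ 12288 * (T ^ 6 * #B) := by gcongr; norm_num
        _ = _ := by ring
    exact_mod_cast this

/-- The theorem of Freiman and Ruzsa over `𝔽₂`. -/
lemma card_span_le_of_small_doubling {B : Finset (Fin n → ZMod 2)} (hB : B.Nonempty) {K : ℕ}
    (h : #(B + B) ≤ K * #B) :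
    #(elems (Submodule.span (ZMod 2) (B : Set (Fin n → ZMod 2)))) ≤ 2 ^ K ^ 4 * (K * #B) := by
  have hsub : ∀ S : Finset (Fin n → ZMod 2), S - S = S + S := by
    intro S
    have hneg : ∀ x : Fin n → ZMod 2, -x = x := fun x =>
      neg_eq_of_add_eq_zero_left (add_self_zmod_two x)
    ext x
    simp_rw [mem_sub, mem_add, fun y z : Fin n → ZMod 2 => sub_eq_add_neg y z, hneg]
  have hBpos : (0 : ℝ) < #B := by exact_mod_cast hB.card_pos
  have h4 : (#((B + B + B) + B) : ℝ) ≤ (K ^ 4 : ℕ) * #B := by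
    have h1 := pluennecke_ruzsa_inequality_nsmul_add hB B 4
    have e : 4 • B = (B + B + B) + B := by simp [succ_nsmul]
    rw [e] at h1
    have h2 : (#(B + B) / #B : ℝ) ≤ K := by
      rw [div_le_iff₀ hBpos]; exact_mod_cast h
    have h3 : (#((B + B + B) + B) : ℝ) ≤ (#(B + B) / #B : ℝ) ^ 4 * #B := by
      have := NNRat.cast_le (K := ℝ).2 h1
      push_cast at this
      exact this
    refine h3.trans ?_
    push_cast
    gcongr
  obtain ⟨X, -, hX, hcov⟩ := ruzsa_covering_add hB h4
  rw [hsub] at hcov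
  have hX' : #X ≤ K ^ 4 := by exact_mod_cast hX
  set W := Submodule.span (ZMod 2) (X : Set (Fin n → ZMod 2)) with hW
  have hWcard : #(elems W) ≤ 2 ^ K ^ 4 := by
    rw [card_elems]
    exact Nat.pow_le_pow_right two_pos ((finrank_span_finset_le_card X).trans hX')
  have hbase : (0 : Fin n → ZMod 2) ∈ elems W + (B + B) := by
    obtain ⟨b, hb⟩ := hB
    exact mem_add.2 ⟨0, mem_elems.2 W.zero_mem, b + b, add_mem_add hb hb,
      by rw [add_self_zmod_two, add_zero]⟩
  have hstep : ∀ u ∈ elems W + (B + B), ∀ b ∈ B, u + b ∈ elems W + (B + B) := by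
    intro u hu b hb
    obtain ⟨w, hw, c, hc, rfl⟩ := mem_add.1 hu
    obtain ⟨x, hx, c', hc', he⟩ := mem_add.1 (hcov (add_mem_add hc hb))
    refine mem_add.2 ⟨w + x, mem_elems.2 (W.add_mem (mem_elems.1 hw) ?_), c', hc', ?_⟩
    · exact Submodule.subset_span hx
    · rw [add_assoc, he, add_assoc]
  have hspan : elems (Submodule.span (ZMod 2) (B : Set (Fin n → ZMod 2))) ⊆
      elems W + (B + B) := by
    intro y hy
    suffices h : ∀ u ∈ elems W + (B + B), u + y ∈ elems W + (B + B) by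
      simpa using h 0 hbase
    refine Submodule.span_induction (p := fun y _ => ∀ u ∈ elems W + (B + B),
      u + y ∈ elems W + (B + B)) (fun b hb u hu => hstep u hu b hb) (fun u hu => by simpa using hu)
      (fun y z _ _ hy hz u hu => ?_) (fun c y _ hy u hu => ?_) (mem_elems.1 hy)
    · rw [← add_assoc u]; exact hz _ (hy u hu)
    · have hc : ∀ c : ZMod 2, c = 0 ∨ c = 1 := by decide
      rcases hc c with rfl | rfl
      · simpa using hu
      · simpa using hy u hu
  calc _ ≤ #(elems W + (B + B)) := card_le_card hspan
    _ ≤ #(elems W) * #(B + B) := card_add_le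
    _ ≤ _ := Nat.mul_le_mul hWcard h

end BalogSzemerediGowers

/-- The set where a function of small spectral norm is not nearly zero is dense on some subspace
of comparable size. -/
lemma exists_comparable_subspace {M : ℕ} (hM : 1 ≤ M) {F : (Fin n → ZMod 2) → ℝ}
    (hF : ∑ r, |F r| ≤ M) {ε : ℝ} (hε0 : 0 ≤ ε) (hε : ε ≤ (1 / 1024) ^ M)
    {A : Finset (Fin n → ZMod 2)} (hne : A.Nonempty) (hA : ∀ x ∈ A, 1 - ε ≤ |walshSum F x|)
    (hA' : ∀ x ∉ A, |walshSum F x| ≤ ε) :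
    ∃ H : Submodule (ZMod 2) (Fin n → ZMod 2),
      #(elems H) ≤ 2 ^ 2 ^ (441 * M ^ 2) * #(A.filter (· ∈ H)) ∧
      #A ≤ 2 ^ 2 ^ (441 * M ^ 2) * #(elems H) := by
  obtain ⟨t, ht⟩ := exists_translate_popular hne
    (exists_subset_sum_mem hM hF hε0 hε hA hA')
  set T := 2 ^ (16 * M ^ 2) with hT
  have hfilter : ((A ×ˢ A).filter fun p => p.1 + p.2 + t ∈ A) =
      (A ×ˢ A).filter fun p => p.1 + p.2 ∈ A.image (· + t) := by
    refine filter_congr fun p _ => ?_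
    rw [mem_image]
    constructor
    · exact fun h => ⟨_, h, by rw [add_assoc, add_self_zmod_two, add_zero]⟩
    · rintro ⟨y, hy, he⟩
      rw [← he, add_assoc, add_self_zmod_two, add_zero]
      exact hy
  rw [hfilter] at ht
  obtain ⟨B, hBA, hAB, hBB⟩ := balog_szemeredi_gowers hne card_image_le Nat.one_le_two_pow ht
  have hB : B.Nonempty := by
    rw [nonempty_iff_ne_empty]
    rintro rfl
    simp [hne.ne_empty] at hAB
  have hspan := card_span_le_of_small_doubling hB hBB
  set H := Submodule.span (ZMod 2) (B : Set (Fin n → ZMod 2)) with hH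
  have hBH : ∀ b ∈ B, b ∈ H := fun b hb => Submodule.subset_span hb
  set s := M ^ 2 with hs
  have hs1 : 1 ≤ s := Nat.one_le_pow _ _ hM
  set K := 12288 * T ^ 6 with hK
  have hKle : K ≤ 2 ^ (110 * s) := by
    calc K ≤ 2 ^ 14 * T ^ 6 := Nat.mul_le_mul_right _ (by norm_num)
      _ = 2 ^ (14 + 96 * s) := by rw [hT, ← pow_mul, ← pow_add]; congr 1; ring
      _ ≤ 2 ^ (110 * s) := Nat.pow_le_pow_right two_pos (by omega)
  have hJ : K ^ 4 + 110 * s ≤ 2 ^ (441 * s) := by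
    calc K ^ 4 + 110 * s ≤ 2 ^ (440 * s) + 2 ^ (440 * s) := by
          refine add_le_add ?_ ?_
          · calc K ^ 4 ≤ (2 ^ (110 * s)) ^ 4 := Nat.pow_le_pow_left hKle 4
              _ = 2 ^ (440 * s) := by rw [← pow_mul]; congr 1; ring
          · exact Nat.lt_two_pow_self.le.trans (Nat.pow_le_pow_right two_pos (by omega))
      _ = 2 ^ (440 * s + 1) := by rw [pow_succ]; ring
      _ ≤ 2 ^ (441 * s) := Nat.pow_le_pow_right two_pos (by omega)
  refine ⟨H, ?_, ?_⟩
  · calc #(elems H) ≤ 2 ^ K ^ 4 * (K * #B) := hspan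
      _ ≤ 2 ^ K ^ 4 * (2 ^ (110 * s) * #B) := by gcongr
      _ = 2 ^ (K ^ 4 + 110 * s) * #B := by rw [pow_add]; ring
      _ ≤ 2 ^ 2 ^ (441 * s) * #(A.filter (· ∈ H)) := by
          gcongr
          · norm_num
          · exact fun b hb => mem_filter.2 ⟨hBA hb, hBH b hb⟩
  · calc #A ≤ 3 * T * #B := hAB
      _ ≤ 2 ^ (110 * s) * #(elems H) := by
          gcongr
          · calc 3 * T ≤ 2 ^ 2 * T := Nat.mul_le_mul_right _ (by norm_num)
              _ = 2 ^ (2 + 16 * s) := by rw [hT, ← pow_add]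
              _ ≤ 2 ^ (110 * s) := Nat.pow_le_pow_right two_pos (by omega)
          · exact fun b hb => mem_elems.2 (hBH b hb)
      _ ≤ 2 ^ 2 ^ (441 * s) * #(elems H) := by
          gcongr
          · norm_num
          · omega

/-- The part of `A` in the coset `x + H`. -/
noncomputable def cosetPart (A : Finset (Fin n → ZMod 2)) (x : Fin n → ZMod 2)
    (H : Submodule (ZMod 2) (Fin n → ZMod 2)) : Finset (Fin n → ZMod 2) :=
  A.filter fun y => x + y ∈ H

lemma sum_mul_walshSum_sq {ι : Type*} (Y : Finset ι) (w : ι → ℝ) (v : ι → Fin n → ZMod 2)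
    (F : (Fin n → ZMod 2) → ℝ) :
    ∑ y ∈ Y, w y * walshSum F (v y) ^ 2 =
      ∑ r, ∑ s, F r * F s * ∑ y ∈ Y, w y * walsh (r + s) (v y) := by
  simp_rw [mul_sum]
  rw [sum_congr rfl fun r _ => sum_comm, sum_comm]
  refine sum_congr rfl fun y _ => ?_
  rw [walshSum, pow_two, sum_mul_sum, mul_sum]
  refine sum_congr rfl fun r _ => ?_
  rw [mul_sum]
  exact sum_congr rfl fun s _ => by rw [walsh_add_left]; ring

lemma card_cosetPart_le (A : Finset (Fin n → ZMod 2)) (x : Fin n → ZMod 2)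
    (H : Submodule (ZMod 2) (Fin n → ZMod 2)) : #(cosetPart A x H) ≤ #(elems H) := by
  refine card_le_card_of_injOn (x + ·) ?_ (fun a _ b _ h => add_left_cancel h)
  intro y hy
  exact mem_elems.2 (mem_filter.1 hy).2

lemma walsh_eq_of_mem_perp {H : Submodule (ZMod 2) (Fin n → ZMod 2)} {t x y : Fin n → ZMod 2}
    (ht : t ∈ perp H) (hxy : x + y ∈ H) : walsh t y = walsh t x := by
  have h := ht _ hxy
  rw [walsh_add_right] at h
  rcases walsh_eq_one_or t x with h1 | h1 <;> rcases walsh_eq_one_or t y with h2 | h2 <;>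
    simp [h1, h2] at h ⊢ <;> linarith

/-- Comparing the mean square of `walshSum F` over `A ∩ (x + H)` and over `x + H`. -/
lemma sum_sq_cosetPart_le (F : (Fin n → ZMod 2) → ℝ) (A : Finset (Fin n → ZMod 2))
    (x : Fin n → ZMod 2) (H : Submodule (ZMod 2) (Fin n → ZMod 2)) {β : ℝ} (hβ0 : 0 ≤ β)
    (hβ : ∀ t ∉ perp H, |∑ y ∈ cosetPart A x H, walsh t y| ≤ β) :
    ∑ y ∈ cosetPart A x H, walshSum F y ^ 2 ≤
      (#(cosetPart A x H) / #(elems H) : ℝ) * ∑ h ∈ elems H, walshSum F (x + h) ^ 2 +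
        (∑ r, |F r|) ^ 2 * β := by
  set κ : ℝ := (#(cosetPart A x H) / #(elems H) : ℝ) with hκ
  have hH0 : (#(elems H) : ℝ) ≠ 0 := by
    rw [card_elems]; positivity
  have h1 := sum_mul_walshSum_sq (cosetPart A x H) (fun _ => (1 : ℝ)) id F
  have h2 := sum_mul_walshSum_sq (elems H) (fun _ => κ) (x + ·) F
  simp only [one_mul, id] at h1
  rw [← mul_sum] at h2
  have hE : ∀ t, |∑ y ∈ cosetPart A x H, walsh t y - ∑ h ∈ elems H, κ * walsh t (x + h)| ≤ β := by
    intro t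
    simp_rw [walsh_add_right, ← mul_sum]
    by_cases ht : t ∈ perp H
    · have hc : ∑ y ∈ cosetPart A x H, walsh t y = ∑ y ∈ cosetPart A x H, walsh t x :=
        sum_congr rfl fun y hy => walsh_eq_of_mem_perp ht (mem_filter.1 hy).2
      rw [sum_walsh_of_mem_perp ht, hc, sum_const, nsmul_eq_mul, hκ]
      have : (#(cosetPart A x H) : ℝ) * walsh t x -
          #(cosetPart A x H) / #(elems H) * (walsh t x * #(elems H)) = 0 := by
        field_simp; ring
      rw [this, abs_zero]
      exact hβ0
    · rw [sum_walsh_of_notMem_perp ht, mul_zero, mul_zero, sub_zero]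
      exact hβ t ht
  have h3 : ∑ y ∈ cosetPart A x H, walshSum F y ^ 2 -
      κ * ∑ h ∈ elems H, walshSum F (x + h) ^ 2 ≤ (∑ r, |F r|) ^ 2 * β := by
    rw [h1, h2, ← sum_sub_distrib, pow_two, sum_mul_sum, sum_mul]
    refine sum_le_sum fun r _ => ?_
    rw [← sum_sub_distrib, sum_mul]
    refine sum_le_sum fun s _ => ?_
    rw [← mul_sub]
    refine (le_abs_self _).trans ?_
    rw [abs_mul, abs_mul]
    exact mul_le_mul_of_nonneg_left (hE _) (by positivity)
  linarith

lemma exists_walsh_neg_one {H : Submodule (ZMod 2) (Fin n → ZMod 2)} {t : Fin n → ZMod 2}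
    (ht : t ∉ perp H) : ∃ k ∈ H, walsh t k = -1 := by
  by_contra! h
  exact ht fun k hk => (walsh_eq_one_or t k).resolve_right (h k hk)

/-- If no half of `x + H` is much richer in elements of `A` than `x + H`, then the characters not
trivial on `H` have small sum over `A ∩ (x + H)`. -/
lemma abs_sum_walsh_cosetPart_le {A : Finset (Fin n → ZMod 2)} {x t : Fin n → ZMod 2}
    {H : Submodule (ZMod 2) (Fin n → ZMod 2)} (ht : t ∉ perp H) {σ : ℝ}
    (h : ∀ y, (#(cosetPart A y (cut H t)) : ℝ) ≤ σ * #(cosetPart A x H)) :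
    |∑ y ∈ cosetPart A x H, walsh t y| ≤ (2 * σ - 1) * #(cosetPart A x H) := by
  obtain ⟨k, hk, hk'⟩ := exists_walsh_neg_one ht
  set C := cosetPart A x H with hC
  have hpos : C.filter (fun y => walsh t (x + y) = 1) = cosetPart A x (cut H t) := by
    ext y
    simp only [hC, cosetPart, mem_filter, mem_cut, and_assoc]
  have hneg : C.filter (fun y => ¬ walsh t (x + y) = 1) = cosetPart A (x + k) (cut H t) := by
    ext y
    simp only [hC, cosetPart, mem_filter, mem_cut, and_assoc]
    have e : x + k + y = x + y + k := by abel
    rw [e, walsh_add_right t (x + y) k, hk', H.add_mem_iff_left hk]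
    rcases walsh_eq_one_or t (x + y) with h1 | h1 <;> rw [h1] <;> norm_num
  have hcard : (#C : ℝ) = #(cosetPart A x (cut H t)) + #(cosetPart A (x + k) (cut H t)) := by
    rw [← hpos, ← hneg]
    exact_mod_cast (card_filter_add_card_filter_not _).symm
  have hsum : ∑ y ∈ C, walsh t (x + y) =
      #(cosetPart A x (cut H t)) - #(cosetPart A (x + k) (cut H t)) := by
    rw [← sum_filter_add_sum_filter_not C (fun y => walsh t (x + y) = 1),
      sum_congr rfl fun y hy => (mem_filter.1 hy).2,
      sum_congr (s₁ := C.filter fun y => ¬ walsh t (x + y) = 1) rfl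
        fun y hy => (walsh_eq_one_or _ _).resolve_left (mem_filter.1 hy).2, hpos, hneg]
    simp; ring
  have habs : |∑ y ∈ C, walsh t y| = |∑ y ∈ C, walsh t (x + y)| := by
    simp_rw [walsh_add_right, ← mul_sum]
    rw [abs_mul, abs_walsh, one_mul]
  rw [habs, hsum, abs_le]
  have h1 := h x
  have h2 := h (x + k)
  constructor <;> linarith

/-- Density increment: from a subspace on which `A` has some density one passes to a coset of a
large subspace of it on which `A` has density at least `1 / (4 M ^ 2)`. -/
lemma exists_dense_coset {M : ℕ} (hM : 1 ≤ M) {F : (Fin n → ZMod 2) → ℝ}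
    (hF : ∑ r, |F r| ≤ M) {ε : ℝ} (hε : ε ≤ 1 / 1024)
    {A : Finset (Fin n → ZMod 2)} (hA : ∀ x ∈ A, 1 - ε ≤ |walshSum F x|)
    (hA' : ∀ x ∉ A, |walshSum F x| ≤ ε) {H₀ : Submodule (ZMod 2) (Fin n → ZMod 2)} {J : ℕ}
    (hH₀ : #(elems H₀) ≤ 2 ^ J * #(A.filter (· ∈ H₀))) :
    ∃ (x : Fin n → ZMod 2) (H : Submodule (ZMod 2) (Fin n → ZMod 2)), H ≤ H₀ ∧
      Module.finrank (ZMod 2) H₀ ≤ Module.finrank (ZMod 2) H + 4 * M ^ 2 * J ∧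
      #(elems H) ≤ 4 * M ^ 2 * #(cosetPart A x H) := by
  have hM' : (1 : ℝ) ≤ M := by exact_mod_cast hM
  set q : ℕ := 4 * M ^ 2 with hq
  have hq4 : (4 : ℝ) ≤ q := by rw [hq]; push_cast; nlinarith
  set ρ : ℝ := 1 + 1 / q with hρ
  have hρ1 : 1 < ρ := by rw [hρ]; have : (0 : ℝ) < 1 / q := by positivity
                         linarith
  have hρ2 : ρ ≤ 2 := by
    have : (1 : ℝ) / q ≤ 1 := by rw [div_le_one (by linarith)]; linarith
    linarith
  set Ψ : {p : (Fin n → ZMod 2) × Submodule (ZMod 2) (Fin n → ZMod 2) // p.2 ≤ H₀} → ℝ :=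
    fun p => #(cosetPart A p.1.1 p.1.2) * (ρ / 2) ^ Module.finrank (ZMod 2) p.1.2 with hΨ
  have : Nonempty {p : (Fin n → ZMod 2) × Submodule (ZMod 2) (Fin n → ZMod 2) // p.2 ≤ H₀} :=
    ⟨⟨(0, H₀), le_rfl⟩⟩
  obtain ⟨⟨⟨x, H⟩, hH⟩, hmax⟩ := Finite.exists_max Ψ
  simp only [hΨ] at hmax hH
  set d₀ := Module.finrank (ZMod 2) H₀
  set d := Module.finrank (ZMod 2) H
  have hcard₀ : (#(elems H₀) : ℝ) = 2 ^ d₀ := by rw [card_elems]; push_cast; rfl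
  have hcard : (#(elems H) : ℝ) = 2 ^ d := by rw [card_elems]; push_cast; rfl
  have hdd : d ≤ d₀ := Submodule.finrank_mono hH
  have h0 : A.filter (· ∈ H₀) = cosetPart A 0 H₀ := by simp [cosetPart]
  have hmax₀ := hmax ⟨(0, H₀), le_rfl⟩
  simp only [← h0] at hmax₀
  have hH₀' : (2 : ℝ) ^ d₀ ≤ 2 ^ J * #(A.filter (· ∈ H₀)) := by
    rw [← hcard₀]; exact_mod_cast hH₀
  have hpos : (0 : ℝ) < #(A.filter (· ∈ H₀)) := by
    by_contra! hcon
    have : (0 : ℝ) < 2 ^ d₀ := by positivity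
    nlinarith [pow_pos (two_pos : (0 : ℝ) < 2) J]
  have ha : (0 : ℝ) < #(cosetPart A x H) := by
    by_contra! hcon
    have h1 : (0 : ℝ) < #(A.filter (· ∈ H₀)) * (ρ / 2) ^ d₀ := by positivity
    have h2 : (0 : ℝ) < (ρ / 2) ^ d := by positivity
    nlinarith
  refine ⟨x, H, hH, ?_, ?_⟩
  · by_contra! hcon
    have h1 : ρ ^ d₀ ≤ 2 ^ J * ρ ^ d := by
      have hle : (#(cosetPart A x H) : ℝ) ≤ 2 ^ d := by
        rw [← hcard]; exact_mod_cast card_cosetPart_le A x H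
      calc ρ ^ d₀ = 2 ^ d₀ * (ρ / 2) ^ d₀ := by rw [← mul_pow]; congr 1; ring
        _ ≤ 2 ^ J * #(A.filter (· ∈ H₀)) * (ρ / 2) ^ d₀ := by gcongr
        _ ≤ 2 ^ J * (2 ^ d * (ρ / 2) ^ d) := by
          rw [mul_assoc]
          exact mul_le_mul_of_nonneg_left
            (hmax₀.trans (mul_le_mul_of_nonneg_right hle (by positivity))) (by positivity)
        _ = 2 ^ J * ρ ^ d := by rw [← mul_pow]; congr 2; ring
    have h2 : (2 : ℝ) ≤ ρ ^ q := by
      have := one_add_mul_le_pow (a := (1 : ℝ) / q) (by linarith [hρ1]) q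
      rw [mul_one_div_cancel (by linarith)] at this
      linarith
    have h3 : 2 ^ J * ρ ^ d < ρ ^ d₀ := by
      calc 2 ^ J * ρ ^ d ≤ (ρ ^ q) ^ J * ρ ^ d := by gcongr
        _ = ρ ^ (d + q * J) := by rw [← pow_mul, ← pow_add, add_comm]
        _ < ρ ^ d₀ := pow_lt_pow_right₀ hρ1 hcon
    linarith
  · by_contra! hcon
    set a : ℝ := (#(cosetPart A x H) : ℝ) with ha_def
    have hhalf : ∀ t ∉ perp H, ∀ y, (#(cosetPart A y (cut H t)) : ℝ) ≤ ρ / 2 * a := by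
      intro t ht y
      have h1 := hmax ⟨(y, cut H t), (cut_le H t).trans hH⟩
      simp only at h1
      set d' := Module.finrank (ZMod 2) (cut H t)
      have hd' : d' + 1 ≤ d := finrank_cut_lt ht
      have h2 : (ρ / 2) ^ d ≤ (ρ / 2) ^ (d' + 1) :=
        pow_le_pow_of_le_one (by positivity) (by linarith) hd'
      have h3 : (0 : ℝ) < (ρ / 2) ^ d' := by positivity
      refine le_of_mul_le_mul_right ?_ h3
      calc _ ≤ a * (ρ / 2) ^ d := h1
        _ ≤ a * (ρ / 2) ^ (d' + 1) := by gcongr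
        _ = _ := by rw [pow_succ]; ring
    have hβ : ∀ t ∉ perp H, |∑ y ∈ cosetPart A x H, walsh t y| ≤ 1 / q * a := by
      intro t ht
      refine (abs_sum_walsh_cosetPart_le ht (hhalf t ht)).trans_eq ?_
      rw [hρ, ← ha_def]; ring
    have hmain := sum_sq_cosetPart_le F A x H (by positivity) hβ
    rw [← ha_def] at hmain
    have hlow : a * (1 - ε) ^ 2 ≤ ∑ y ∈ cosetPart A x H, walshSum F y ^ 2 := by
      rw [ha_def, ← nsmul_eq_mul]
      refine card_nsmul_le_sum _ _ _ fun y hy => ?_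
      rw [← sq_abs (walshSum F y)]
      exact pow_le_pow_left₀ (by linarith) (hA y (mem_filter.1 hy).1) 2
    have hup : ∑ h ∈ elems H, walshSum F (x + h) ^ 2 ≤ a * M ^ 2 + #(elems H) * ε ^ 2 := by
      have h1 : ∀ h ∈ elems H, walshSum F (x + h) ^ 2 ≤
          (if x + h ∈ A then (M : ℝ) ^ 2 else 0) + ε ^ 2 := by
        intro h _
        rw [← sq_abs (walshSum F (x + h))]
        split_ifs with hh
        · have := pow_le_pow_left₀ (abs_nonneg _) ((abs_walshSum_le F (x + h)).trans hF) 2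
          nlinarith
        · rw [zero_add]
          exact pow_le_pow_left₀ (abs_nonneg _) (hA' _ hh) 2
      refine (sum_le_sum h1).trans ?_
      rw [sum_add_distrib, sum_const, nsmul_eq_mul, ← sum_filter, sum_const, nsmul_eq_mul]
      gcongr
      rw [ha_def]
      norm_cast
      refine card_le_card_of_injOn (x + ·) ?_ (fun a _ b _ h => add_left_cancel h)
      intro h hh
      simp only [coe_filter, Set.mem_ofPred_eq, mem_elems] at hh
      refine mem_filter.2 ⟨hh.2, ?_⟩
      rw [← add_assoc, add_self_zmod_two, zero_add]
      exact hh.1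
    have hHpos : (0 : ℝ) < #(elems H) := by rw [hcard]; positivity
    have hcon' : (q : ℝ) * a < #(elems H) := by rw [ha_def]; exact_mod_cast hcon
    have hdens : a / #(elems H) * (a * M ^ 2) ≤ a / 4 := by
      rw [div_mul_eq_mul_div, div_le_iff₀ hHpos]
      have : (q : ℝ) = 4 * M ^ 2 := by rw [hq]; push_cast; rfl
      rw [this] at hcon'
      nlinarith
    have hF2 : (∑ r, |F r|) ^ 2 * (1 / q * a) ≤ a / 4 := by
      have hqM : (q : ℝ) = 4 * M ^ 2 := by rw [hq]; push_cast; rfl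
      calc (∑ r, |F r|) ^ 2 * (1 / q * a) ≤ M ^ 2 * (1 / q * a) := by
            gcongr
        _ = a / 4 := by rw [hqM]; field_simp
    have hstep : a / #(elems H) * ∑ h ∈ elems H, walshSum F (x + h) ^ 2 ≤ a / 4 + a * ε ^ 2 := by
      calc _ ≤ a / #(elems H) * (a * M ^ 2 + #(elems H) * ε ^ 2) := by gcongr
        _ = a / #(elems H) * (a * M ^ 2) + a * ε ^ 2 := by field_simp
        _ ≤ _ := by linarith
    have : a * (1 - ε) ^ 2 ≤ a * (1 / 2 + ε ^ 2) := by linarith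
    have := le_of_mul_le_mul_left this ha
    have hexp : (1 - ε) ^ 2 = 1 - 2 * ε + ε ^ 2 := by ring
    linarith

/-- A bounded codimension refinement of `H₁` on which the nontrivial cosets of the annihilator carry
little Fourier mass. -/
lemma exists_regular_subspace {M : ℝ} {F : (Fin n → ZMod 2) → ℝ} (hF : ∑ r, |F r| ≤ M) {δ : ℝ}
    (hδ : 0 < δ) {D : ℕ} (hD : M ≤ δ * D) (H₁ : Submodule (ZMod 2) (Fin n → ZMod 2)) :
    ∃ H ≤ H₁, Module.finrank (ZMod 2) H₁ ≤ Module.finrank (ZMod 2) H + D ∧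
      ∀ t ∉ perp H, ∑ r, (if r + t ∈ perp H then |F r| else 0) ≤ δ := by
  set S : Submodule (ZMod 2) (Fin n → ZMod 2) → ℝ :=
    fun H => ∑ r, if r ∈ perp H then |F r| else 0 with hS
  have : Nonempty {H : Submodule (ZMod 2) (Fin n → ZMod 2) // H ≤ H₁} := ⟨⟨H₁, le_rfl⟩⟩
  obtain ⟨⟨H, hH⟩, hmax⟩ := Finite.exists_max
    fun H : {H : Submodule (ZMod 2) (Fin n → ZMod 2) // H ≤ H₁} =>
      S H.1 + δ * Module.finrank (ZMod 2) H.1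
  refine ⟨H, hH, ?_, fun t ht => ?_⟩
  · have h1 := hmax ⟨H₁, le_rfl⟩
    have h2 : 0 ≤ S H₁ := sum_nonneg fun r _ => by split_ifs <;> positivity
    have h3 : S H ≤ ∑ r, |F r| := sum_le_sum fun r _ => by
      split_ifs
      · exact le_rfl
      · positivity
    simp only at h1
    have h4 : δ * (Module.finrank (ZMod 2) H₁ : ℝ) ≤ δ * (Module.finrank (ZMod 2) H + D) := by
      rw [mul_add]; linarith
    exact_mod_cast le_of_mul_le_mul_left h4 hδ
  · have h1 := hmax ⟨cut H t, (cut_le H t).trans hH⟩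
    simp only at h1
    have h2 : (Module.finrank (ZMod 2) H : ℝ) ≤ Module.finrank (ZMod 2) (cut H t) + 1 := by
      exact_mod_cast finrank_le_finrank_cut H t
    have h3 : S H + ∑ r, (if r + t ∈ perp H then |F r| else 0) ≤ S (cut H t) := by
      simp only [hS]
      rw [← sum_add_distrib]
      refine sum_le_sum fun r _ => ?_
      by_cases hr : r ∈ perp H
      · have hrt : r + t ∉ perp H := fun h => ht <| by
          have := add_mem_perp hr h
          rwa [← add_assoc, add_self_zmod_two, zero_add] at this
        rw [if_pos hr, if_neg hrt, if_pos (perp_anti (cut_le H t) hr), add_zero]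
      · rw [if_neg hr, zero_add]
        by_cases hrt : r + t ∈ perp H
        · rw [if_pos hrt, if_pos]
          intro h hh
          have := hrt h (cut_le H t hh)
          rwa [walsh_add_left, (mem_cut.1 hh).2, mul_one] at this
        · rw [if_neg hrt]; split_ifs <;> positivity
    have h4 := mul_le_mul_of_nonneg_left h2 hδ.le
    linarith

/-- The restriction of `F` to the annihilator of `H`. -/
noncomputable def onPerp (H : Submodule (ZMod 2) (Fin n → ZMod 2)) (F : (Fin n → ZMod 2) → ℝ)
    (r : Fin n → ZMod 2) : ℝ := if r ∈ perp H then F r else 0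

/-- The restriction of `F` to the complement of the annihilator of `H`. -/
noncomputable def offPerp (H : Submodule (ZMod 2) (Fin n → ZMod 2)) (F : (Fin n → ZMod 2) → ℝ)
    (r : Fin n → ZMod 2) : ℝ := if r ∈ perp H then 0 else F r

lemma walshSum_onPerp_add_offPerp (H : Submodule (ZMod 2) (Fin n → ZMod 2))
    (F : (Fin n → ZMod 2) → ℝ) (x : Fin n → ZMod 2) :
    walshSum (onPerp H F) x + walshSum (offPerp H F) x = walshSum F x := by
  rw [walshSum, walshSum, walshSum, ← sum_add_distrib]
  refine sum_congr rfl fun r _ => ?_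
  rw [onPerp, offPerp]
  split_ifs <;> ring

lemma sum_abs_onPerp_add_offPerp (H : Submodule (ZMod 2) (Fin n → ZMod 2))
    (F : (Fin n → ZMod 2) → ℝ) :
    ∑ r, |onPerp H F r| + ∑ r, |offPerp H F r| = ∑ r, |F r| := by
  rw [← sum_add_distrib]
  refine sum_congr rfl fun r _ => ?_
  rw [onPerp, offPerp]
  split_ifs <;> simp

lemma walshSum_onPerp_add {H : Submodule (ZMod 2) (Fin n → ZMod 2)} (F : (Fin n → ZMod 2) → ℝ)
    (x : Fin n → ZMod 2) {h : Fin n → ZMod 2} (hh : h ∈ H) :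
    walshSum (onPerp H F) (x + h) = walshSum (onPerp H F) x := by
  refine sum_congr rfl fun r _ => ?_
  rw [onPerp]
  split_ifs with hr
  · rw [walsh_add_right, hr h hh, mul_one]
  · simp

lemma sum_sq_offPerp_le {M : ℝ} {F : (Fin n → ZMod 2) → ℝ} (hF : ∑ r, |F r| ≤ M) {δ : ℝ}
    (hδ : 0 ≤ δ) {H : Submodule (ZMod 2) (Fin n → ZMod 2)}
    (hH : ∀ t ∉ perp H, ∑ r, (if r + t ∈ perp H then |F r| else 0) ≤ δ) (x : Fin n → ZMod 2) :
    ∑ h ∈ elems H, walshSum (offPerp H F) (x + h) ^ 2 ≤ #(elems H) * (δ * M) := by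
  have h1 := sum_mul_walshSum_sq (elems H) (fun _ => (1 : ℝ)) (x + ·) (offPerp H F)
  simp only [one_mul] at h1
  rw [h1]
  have hterm : ∀ r s, offPerp H F r * offPerp H F s * ∑ h ∈ elems H, walsh (r + s) (x + h) ≤
      |offPerp H F r| * (if s + r ∈ perp H then |F s| else 0) * #(elems H) := by
    intro r s
    simp_rw [walsh_add_right, ← mul_sum]
    rw [add_comm s r]
    by_cases hrs : r + s ∈ perp H
    · rw [if_pos hrs, sum_walsh_of_mem_perp hrs, ← mul_assoc]
      refine mul_le_mul_of_nonneg_right ((le_abs_self _).trans ?_) (by positivity)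
      rw [abs_mul, abs_walsh, mul_one, abs_mul]
      refine mul_le_mul_of_nonneg_left ?_ (abs_nonneg _)
      rw [offPerp]
      split_ifs
      · simp
      · exact le_rfl
    · rw [if_neg hrs, sum_walsh_of_notMem_perp hrs]; simp
  have hrow : ∀ r, ∑ s, offPerp H F r * offPerp H F s *
      ∑ h ∈ elems H, walsh (r + s) (x + h) ≤ |F r| * δ * #(elems H) := by
    intro r
    refine (sum_le_sum fun s _ => hterm r s).trans ?_
    rw [← sum_mul, ← mul_sum]
    refine mul_le_mul_of_nonneg_right ?_ (by positivity)
    by_cases hr : r ∈ perp H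
    · rw [offPerp, if_pos hr, abs_zero, zero_mul]; positivity
    · rw [offPerp, if_neg hr]
      exact mul_le_mul_of_nonneg_left (hH r hr) (abs_nonneg _)
  refine (sum_le_sum fun r _ => hrow r).trans ?_
  rw [← sum_mul, ← sum_mul]
  nlinarith [mul_le_mul_of_nonneg_right hF hδ, mul_le_mul_of_nonneg_right
    (mul_le_mul_of_nonneg_right hF hδ) (Nat.cast_nonneg (α := ℝ) #(elems H))]

/-- An integral bound on all cosets of `H` passes to cosets of larger subspaces. -/
lemma sum_elems_le_of_le {H K : Submodule (ZMod 2) (Fin n → ZMod 2)} (hHK : H ≤ K)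
    {φ : (Fin n → ZMod 2) → ℝ} {c : ℝ} (hφ : ∀ x, ∑ h ∈ elems H, φ (x + h) ≤ #(elems H) * c)
    (x : Fin n → ZMod 2) : ∑ k ∈ elems K, φ (x + k) ≤ #(elems K) * c := by
  have hpos : (0 : ℝ) < #(elems H) := by rw [card_elems]; positivity
  refine le_of_mul_le_mul_left ?_ hpos
  calc #(elems H) * ∑ k ∈ elems K, φ (x + k)
      = ∑ h ∈ elems H, ∑ k ∈ elems K, φ (x + k) := by rw [sum_const, nsmul_eq_mul]
    _ = ∑ h ∈ elems H, ∑ k ∈ elems K, φ (x + (k + h)) :=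
        sum_congr rfl fun h hh =>
          (sum_elems_add K (hHK (mem_elems.1 hh)) fun k => φ (x + k)).symm
    _ = ∑ k ∈ elems K, ∑ h ∈ elems H, φ (x + k + h) := by
        rw [sum_comm]; simp_rw [add_assoc]
    _ ≤ ∑ k ∈ elems K, #(elems H) * c := sum_le_sum fun k _ => hφ _
    _ = #(elems H) * (#(elems K) * c) := by rw [sum_const, nsmul_eq_mul]; ring

/-- One step of the decomposition: a subspace `H` of size comparable to the support `A`, for which
the part of `walshSum F` off the annihilator of `H` is small somewhere on each coset of `H` and at
some point of `A`. -/
lemma exists_splitting_subspace {M : ℕ} (hM : 1 ≤ M) {F : (Fin n → ZMod 2) → ℝ}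
    (hF : ∑ r, |F r| ≤ M) {ε : ℝ} (hε0 : 0 ≤ ε) (hε : ε ≤ (1 / 1024) ^ M)
    {A : Finset (Fin n → ZMod 2)} (hne : A.Nonempty) (hA : ∀ x ∈ A, 1 - ε ≤ |walshSum F x|)
    (hA' : ∀ x ∉ A, |walshSum F x| ≤ ε) {η : ℝ} (hη : 0 < η) (hηM : 8 * M * η ≤ 1) {D : ℕ}
    (hD : M ^ 2 ≤ η ^ 2 * D) :
    ∃ H : Submodule (ZMod 2) (Fin n → ZMod 2),
      #A ≤ 2 ^ (2 ^ (441 * M ^ 2) * (4 * M ^ 2 + 1) + D) * #(elems H) ∧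
      (∀ x, ∃ h ∈ H, |walshSum (offPerp H F) (x + h)| ≤ η) ∧
      ∃ y ∈ A, |walshSum (offPerp H F) y| ≤ 1 / 4 := by
  have hM' : (1 : ℝ) ≤ M := by exact_mod_cast hM
  obtain ⟨H₀, hH₀, hA₀⟩ := exists_comparable_subspace hM hF hε0 hε hne hA hA'
  set J := 2 ^ (441 * M ^ 2)
  have hε1 : ε ≤ 1 / 1024 := hε.trans (pow_le_of_le_one (by norm_num) (by norm_num) (by omega))
  obtain ⟨x, K, hK, hKd, hKc⟩ := exists_dense_coset hM hF hε1 hA hA' hH₀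
  have hδ : 0 < η ^ 2 / M := by positivity
  obtain ⟨H, hH, hHd, hreg⟩ := exists_regular_subspace hF hδ (D := D)
    (by rw [div_mul_eq_mul_div, le_div_iff₀ (by linarith)]; linarith) K
  have hL2 := sum_sq_offPerp_le hF hδ.le hreg
  rw [div_mul_cancel₀ _ (by linarith)] at hL2
  refine ⟨H, ?_, fun x => ?_, ?_⟩
  · refine hA₀.trans ?_
    rw [card_elems, card_elems, ← pow_add, ← pow_add]
    refine Nat.pow_le_pow_right two_pos ?_
    have : J * (4 * M ^ 2 + 1) = J + 4 * M ^ 2 * J := by ring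
    omega
  · by_contra! hcon
    have h1 : ∑ h ∈ elems H, η ^ 2 < ∑ h ∈ elems H, walshSum (offPerp H F) (x + h) ^ 2 := by
      refine sum_lt_sum_of_nonempty ⟨0, mem_elems.2 H.zero_mem⟩ fun h hh => ?_
      rw [← sq_abs (walshSum _ _)]
      exact pow_lt_pow_left₀ (hcon h (mem_elems.1 hh)) hη.le two_ne_zero
    rw [sum_const, nsmul_eq_mul] at h1
    linarith [hL2 x]
  · by_contra! hcon
    have hsum := sum_elems_le_of_le hH (φ := fun y => walshSum (offPerp H F) y ^ 2) hL2 x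
    have hle : ∑ y ∈ cosetPart A x K, walshSum (offPerp H F) y ^ 2 ≤
        ∑ k ∈ elems K, walshSum (offPerp H F) (x + k) ^ 2 := by
      have himg : ∑ y ∈ cosetPart A x K, walshSum (offPerp H F) y ^ 2 =
          ∑ k ∈ (cosetPart A x K).image (x + ·), walshSum (offPerp H F) (x + k) ^ 2 := by
        rw [sum_image fun a _ b _ h => add_left_cancel h]
        refine sum_congr rfl fun y _ => ?_
        rw [← add_assoc, add_self_zmod_two, zero_add]
      rw [himg]
      refine sum_le_sum_of_subset_of_nonneg ?_ fun _ _ _ => sq_nonneg _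
      intro k hk
      obtain ⟨y, hy, rfl⟩ := mem_image.1 hk
      exact mem_elems.2 (mem_filter.1 hy).2
    have hKpos : 0 < #(elems K) := by rw [card_elems]; positivity
    have hCpos : 0 < #(cosetPart A x K) := by
      rcases Nat.eq_zero_or_pos #(cosetPart A x K) with h | h
      · rw [h] at hKc; omega
      · exact h
    have hlt : #(cosetPart A x K) * (1 / 4 : ℝ) ^ 2 <
        ∑ y ∈ cosetPart A x K, walshSum (offPerp H F) y ^ 2 := by
      rw [← nsmul_eq_mul, ← sum_const]
      refine sum_lt_sum_of_nonempty (card_pos.1 hCpos) fun y hy => ?_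
      rw [← sq_abs (walshSum _ _)]
      exact pow_lt_pow_left₀ (hcon y (mem_filter.1 hy).1) (by norm_num) two_ne_zero
    have hKc' : (#(elems K) : ℝ) ≤ 4 * M ^ 2 * #(cosetPart A x K) := by exact_mod_cast hKc
    have hηsq : 4 * M ^ 2 * η ^ 2 ≤ (1 / 4 : ℝ) ^ 2 := by
      have := pow_le_pow_left₀ (by positivity) hηM 2
      nlinarith
    have h2 : (#(elems K) : ℝ) * η ^ 2 ≤ #(cosetPart A x K) * (1 / 4) ^ 2 :=
      calc (#(elems K) : ℝ) * η ^ 2 ≤ 4 * M ^ 2 * #(cosetPart A x K) * η ^ 2 := by gcongr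
        _ = #(cosetPart A x K) * (4 * M ^ 2 * η ^ 2) := by ring
        _ ≤ _ := by gcongr
    linarith

/-- `z` is a signed sum of at most `L` indicators of subspaces. -/
def IsSignedSum (L : ℕ) (z : (Fin n → ZMod 2) → ℤ) : Prop :=
  ∃ s : List (ℤ × Submodule (ZMod 2) (Fin n → ZMod 2)), s.length ≤ L ∧
    (∀ p ∈ s, p.1 = 1 ∨ p.1 = -1) ∧
    ∀ x, z x = (s.map fun p => p.1 * if x ∈ p.2 then 1 else 0).sum

lemma IsSignedSum.mono {L L' : ℕ} {z : (Fin n → ZMod 2) → ℤ} (h : IsSignedSum L z)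
    (hL : L ≤ L') : IsSignedSum L' z := by
  obtain ⟨s, hs, h⟩ := h
  exact ⟨s, hs.trans hL, h⟩

lemma isSignedSum_of_forall_eq_zero (L : ℕ) {z : (Fin n → ZMod 2) → ℤ} (h : ∀ x, z x = 0) :
    IsSignedSum L z :=
  ⟨[], by simp, by simp, by simpa using h⟩

lemma IsSignedSum.add {L L' : ℕ} {z z' : (Fin n → ZMod 2) → ℤ} (h : IsSignedSum L z)
    (h' : IsSignedSum L' z') : IsSignedSum (L + L') fun x => z x + z' x := by
  obtain ⟨s, hs, hsign, hz⟩ := h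
  obtain ⟨s', hs', hsign', hz'⟩ := h'
  refine ⟨s ++ s', by simp only [List.length_append]; omega, ?_, fun x => ?_⟩
  · intro p hp
    rcases List.mem_append.1 hp with hp | hp
    exacts [hsign p hp, hsign' p hp]
  · simp only [List.map_append, List.sum_append, hz, hz']

lemma IsSignedSum.neg {L : ℕ} {z : (Fin n → ZMod 2) → ℤ} (h : IsSignedSum L z) :
    IsSignedSum L fun x => -z x := by
  obtain ⟨s, hs, hsign, hz⟩ := h
  refine ⟨s.map fun p => (-p.1, p.2), by simpa using hs, ?_, fun x => ?_⟩
  · intro p hp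
    obtain ⟨q, hq, rfl⟩ := List.mem_map.1 hp
    rcases hsign q hq with h | h <;> simp [h]
  · simp only [hz x, List.sum_neg, List.map_map]
    congr 1
    exact List.map_congr_left fun p _ => (neg_mul _ _).symm

lemma isSignedSum_coset (x : Fin n → ZMod 2) (H : Submodule (ZMod 2) (Fin n → ZMod 2)) :
    IsSignedSum 2 fun y => if x + y ∈ H then 1 else 0 := by
  by_cases hx : x ∈ H
  · refine ⟨[(1, H)], by simp, by simp, fun y => ?_⟩
    simp [H.add_mem_iff_right hx]
  · refine ⟨[(1, H ⊔ Submodule.span (ZMod 2) {x}), (-1, H)], by simp, by simp, fun y => ?_⟩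
    have hmem : y ∈ H ⊔ Submodule.span (ZMod 2) {x} ↔ y ∈ H ∨ x + y ∈ H := by
      rw [Submodule.mem_sup]
      constructor
      · rintro ⟨h, hh, w, hw, rfl⟩
        obtain ⟨c, rfl⟩ := Submodule.mem_span_singleton.1 hw
        have hc : ∀ c : ZMod 2, c = 0 ∨ c = 1 := by decide
        rcases hc c with rfl | rfl
        · left; simpa using hh
        · right
          rwa [one_smul, add_comm h, ← add_assoc, add_self_zmod_two, zero_add]
      · rintro (h | h)
        · exact ⟨y, h, 0, Submodule.zero_mem _, add_zero y⟩
        · refine ⟨x + y, h, x, Submodule.mem_span_singleton_self x, ?_⟩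
          rw [add_comm x y, add_assoc, add_self_zmod_two, add_zero]
    have hexcl : y ∈ H → x + y ∉ H := fun hy hxy => hx ((H.add_mem_iff_left hy).1 hxy)
    by_cases hy : y ∈ H
    · simp [hmem, hy, hexcl hy]
    · simp [hmem, hy]

lemma IsSignedSum.nat_mul {L : ℕ} {z : (Fin n → ZMod 2) → ℤ} (h : IsSignedSum L z) (c : ℕ) :
    IsSignedSum (c * L) fun x => c * z x := by
  induction c with
  | zero => exact isSignedSum_of_forall_eq_zero _ (by simp)
  | succ c ih =>
    convert ih.add h using 1
    · ring
    · ext x; push_cast; ring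

lemma IsSignedSum.int_mul {L M : ℕ} {z : (Fin n → ZMod 2) → ℤ} (h : IsSignedSum L z) {c : ℤ}
    (hc : |c| ≤ M) : IsSignedSum (M * L) fun x => c * z x := by
  obtain ⟨m, rfl | rfl⟩ := Int.eq_nat_or_neg c
  · have hm : m ≤ M := by simpa using hc
    exact (h.nat_mul m).mono (Nat.mul_le_mul_right L hm)
  · have hm : m ≤ M := by simpa using hc
    convert ((h.nat_mul m).mono (Nat.mul_le_mul_right L hm)).neg using 2
    ring

/-- An `H`-invariant function whose support is covered by few cosets of `H` is a short signed sum of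
indicators of subspaces. -/
lemma isSignedSum_of_invariant {M : ℕ} {H : Submodule (ZMod 2) (Fin n → ZMod 2)} (j : ℕ) :
    ∀ z : (Fin n → ZMod 2) → ℤ, (∀ x, ∀ h ∈ H, z (x + h) = z x) → (∀ x, |z x| ≤ M) →
      #(univ.filter fun x => z x ≠ 0) ≤ j * #(elems H) → IsSignedSum (j * (M * 2)) z := by
  induction j with
  | zero =>
    intro z _ _ hcard
    refine isSignedSum_of_forall_eq_zero _ fun x => ?_
    rw [zero_mul, Nat.le_zero, card_eq_zero] at hcard
    by_contra hx
    have : x ∈ univ.filter fun x => z x ≠ 0 := by simpa using hx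
    simp [hcard] at this
  | succ j ih =>
    intro z hinv hbd hcard
    by_cases hz : ∀ x, z x = 0
    · exact isSignedSum_of_forall_eq_zero _ hz
    push Not at hz
    obtain ⟨x, hx⟩ := hz
    have hcoset : ∀ y, x + y ∈ H → z y = z x := fun y hy => by
      have := hinv x _ hy
      rwa [← add_assoc, add_self_zmod_two, zero_add] at this
    set z' : (Fin n → ZMod 2) → ℤ := fun y => if x + y ∈ H then 0 else z y with hz'
    have hsub : (univ.filter fun y => z' y ≠ 0) ∪ (elems H).image (x + ·) ⊆
        univ.filter fun y => z y ≠ 0 := by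
      intro y hy
      rw [mem_filter]
      refine ⟨mem_univ _, ?_⟩
      rcases mem_union.1 hy with hy | hy
      · have := (mem_filter.1 hy).2
        simp only [hz'] at this
        split_ifs at this with h
        · exact absurd rfl this
        · exact this
      · obtain ⟨h, hh, rfl⟩ := mem_image.1 hy
        rwa [hinv x h (mem_elems.1 hh)]
    have hdisj : Disjoint (univ.filter fun y => z' y ≠ 0) ((elems H).image (x + ·)) := by
      rw [disjoint_right]
      intro y hy
      obtain ⟨h, hh, rfl⟩ := mem_image.1 hy
      simp [hz', ← add_assoc, add_self_zmod_two, mem_elems.1 hh]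
    have hcard' := card_le_card hsub
    rw [card_union_of_disjoint hdisj, card_image_of_injective _ (add_right_injective x)] at hcard'
    have hrec := ih z' (fun y h hh => by
        simp only [hz', ← add_assoc, H.add_mem_iff_left hh, hinv y h hh])
      (fun y => by
        simp only [hz']
        split_ifs
        · simp
        · exact hbd y)
      (by rw [add_mul, one_mul] at hcard; omega)
    convert hrec.add ((isSignedSum_coset x H).int_mul (hbd x)) using 1
    · ring
    · ext y
      simp only [hz']
      split_ifs with h
      · simp [hcoset y h]
      · simp

/-- A function of small spectral norm that is close to an integer-valued function `z` gives a
representation of `z`; each unit of `k` accounts for `1 / 2` of spectral norm. -/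
lemma isSignedSum_of_near {M : ℕ} (hM : 1 ≤ M) {η : ℝ} (hη : 0 < η) (hηM : 8 * M * η ≤ 1) {D : ℕ}
    (hD : M ^ 2 ≤ η ^ 2 * D) (k : ℕ) :
    ∀ (F : (Fin n → ZMod 2) → ℝ) (z : (Fin n → ZMod 2) → ℤ) (ε : ℝ), 0 ≤ ε →
      ∑ r, |F r| ≤ k / 2 → ∑ r, |F r| ≤ M → (∀ x, |walshSum F x - z x| ≤ ε) →
      2 ^ k * (ε + η) ≤ (1 / 1024) ^ M →
      IsSignedSum (2 ^ k * (2 ^ (2 ^ (441 * M ^ 2) * (4 * M ^ 2 + 1) + D) * (M * 2))) z := by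
  have hsmall : (1 / 1024 : ℝ) ^ M ≤ 1 / 1024 :=
    pow_le_of_le_one (by norm_num) (by norm_num) (by omega)
  have hge_one : ∀ m : ℤ, m ≠ 0 → (1 : ℝ) ≤ |(m : ℝ)| := fun m hm => by
    exact_mod_cast Int.one_le_abs hm
  set E := 2 ^ (441 * M ^ 2) * (4 * M ^ 2 + 1) + D
  induction k with
  | zero =>
    intro F z ε hε0 hk _ hz hε
    refine isSignedSum_of_forall_eq_zero _ fun x => ?_
    by_contra hx
    have h1 := hge_one _ hx
    have h2 := (abs_walshSum_le F x).trans hk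
    have h3 := abs_sub_abs_le_abs_sub (z x : ℝ) (walshSum F x)
    rw [abs_sub_comm] at h3
    have h4 := hz x
    rw [Nat.cast_zero, zero_div] at h2
    rw [pow_zero, one_mul] at hε
    linarith
  | succ k ih =>
    intro F z ε hε0 hk hF hz hε
    have hεη : ε + η ≤ (1 / 1024) ^ M := by
      refine le_trans ?_ hε
      exact le_mul_of_one_le_left (by linarith) (one_le_pow₀ (by norm_num))
    set A := univ.filter fun x => z x ≠ 0 with hA
    have hmemA : ∀ x, x ∈ A ↔ z x ≠ 0 := fun x => by simp [hA]
    rcases A.eq_empty_or_nonempty with hne | hne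
    · refine isSignedSum_of_forall_eq_zero _ fun x => ?_
      by_contra hx
      have := (hmemA x).2 hx
      simp [hne] at this
    have hAlow : ∀ x ∈ A, 1 - ε ≤ |walshSum F x| := fun x hx => by
      have h1 := hge_one _ ((hmemA x).1 hx)
      have h2 := abs_sub_abs_le_abs_sub (z x : ℝ) (walshSum F x)
      rw [abs_sub_comm] at h2
      linarith [hz x]
    have hAup : ∀ x ∉ A, |walshSum F x| ≤ ε := fun x hx => by
      have h1 : z x = 0 := by simpa [hmemA] using hx
      simpa [h1] using hz x
    obtain ⟨H, hcard, hnear, y, hy, hgy⟩ :=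
      exists_splitting_subspace hM hF hε0 (by linarith) hne hAlow hAup hη hηM hD
    have hsplit := walshSum_onPerp_add_offPerp H F
    have hnorm := sum_abs_onPerp_add_offPerp H F
    set g := walshSum (onPerp H F) with hg
    set g' := walshSum (offPerp H F) with hg'
    have hginv : ∀ x, ∀ h ∈ H, g (x + h) = g x := fun x h hh => walshSum_onPerp_add F x hh
    have hground : ∀ x, |g x - round (g x)| ≤ ε + η := fun x => by
      obtain ⟨h, hh, hη'⟩ := hnear x
      refine (round_le (g x) (z (x + h))).trans ?_
      have e : g x - z (x + h) = (walshSum F (x + h) - z (x + h)) - g' (x + h) := by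
        rw [← hsplit, hginv x h hh]; ring
      rw [e]
      exact (abs_sub _ _).trans (add_le_add (hz _) hη')
    have hground' : ∀ x, |g' x - ((z x - round (g x) : ℤ) : ℝ)| ≤ 2 * ε + η := fun x => by
      have e : g' x - ((z x - round (g x) : ℤ) : ℝ) =
          (walshSum F x - z x) - (g x - round (g x)) := by
        rw [← hsplit]; push_cast; ring
      rw [e]
      linarith [abs_sub (walshSum F x - z x) (g x - round (g x)), hz x, hground x]
    by_cases hzero : ∀ x, z x - round (g x) = 0
    · have hzg : ∀ x, z x = round (g x) := fun x => by have := hzero x; omega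
      refine (isSignedSum_of_invariant (M := M) (H := H) (2 ^ E) z (fun x h hh => ?_)
        (fun x => ?_) hcard).mono (Nat.le_mul_of_pos_left _ (by positivity))
      · rw [hzg, hzg, hginv x h hh]
      · have h1 := abs_sub_abs_le_abs_sub (z x : ℝ) (walshSum F x)
        rw [abs_sub_comm] at h1
        have h2 : |(z x : ℝ)| < M + 1 := by
          linarith [hz x, (abs_walshSum_le F x).trans hF]
        have h3 : |z x| < M + 1 := by exact_mod_cast h2
        omega
    · push Not at hzero
      obtain ⟨x, hx⟩ := hzero
      have hoff : 1 / 2 ≤ ∑ r, |offPerp H F r| := by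
        have h1 := hge_one _ hx
        have h2 := abs_sub_abs_le_abs_sub ((z x - round (g x) : ℤ) : ℝ) (g' x)
        rw [abs_sub_comm] at h2
        linarith [hground' x, abs_walshSum_le (offPerp H F) x]
      have hon : 1 / 2 ≤ ∑ r, |onPerp H F r| := by
        have h1 := hAlow y hy
        rw [← hsplit] at h1
        linarith [abs_add_le (g y) (g' y), abs_walshSum_le (onPerp H F) y]
      have hk' : (∑ r, |F r|) ≤ k / 2 + 1 / 2 := by
        push_cast at hk; linarith
      rw [pow_succ] at hε
      have hε' : 2 ^ k * (2 * ε + η + η) ≤ (1 / 1024) ^ M := by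
        refine le_trans (le_of_eq ?_) hε; ring
      have h1 := ih (onPerp H F) (fun x => round (g x)) (2 * ε + η) (by linarith) (by linarith)
        (by linarith) (fun x => (hground x).trans (by linarith)) hε'
      have h2 := ih (offPerp H F) (fun x => z x - round (g x)) (2 * ε + η) (by linarith)
        (by linarith) (by linarith) hground' hε'
      convert h1.add h2 using 1
      · ring
      · ext x; ring

lemma length_bound {M : ℕ} (hM : 1 ≤ M) :
    2 ^ (2 * M) * (2 ^ (2 ^ (441 * M ^ 2) * (4 * M ^ 2 + 1) + M ^ 2 * 2 ^ (24 * M)) * (M * 2)) ≤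
      2 ^ 2 ^ (500 * M ^ 2) := by
  have hMs : M ≤ M ^ 2 := Nat.le_self_pow two_ne_zero M
  set s := M ^ 2
  have hs : s ≤ 2 ^ s := Nat.lt_two_pow_self.le
  have hM2 : M ≤ 2 ^ M := Nat.lt_two_pow_self.le
  calc _ ≤ 2 ^ (2 * M) *
        (2 ^ (2 ^ (441 * s) * (4 * s + 1) + s * 2 ^ (24 * M)) * (2 ^ M * 2)) := by gcongr
    _ = 2 ^ (3 * M + 1 + (2 ^ (441 * s) * (4 * s + 1) + s * 2 ^ (24 * M))) := by ring
    _ ≤ 2 ^ 2 ^ (500 * s) := by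
      refine Nat.pow_le_pow_right two_pos ?_
      have h1 : 3 * M + 1 ≤ 2 ^ (448 * s) := by
        calc 3 * M + 1 ≤ 2 ^ 2 * 2 ^ s := by omega
          _ = 2 ^ (2 + s) := by rw [pow_add]
          _ ≤ _ := Nat.pow_le_pow_right two_pos (by omega)
      have h2 : 2 ^ (441 * s) * (4 * s + 1) ≤ 2 ^ (448 * s) := by
        calc 2 ^ (441 * s) * (4 * s + 1) ≤ 2 ^ (441 * s) * (2 ^ 3 * 2 ^ s) := by
              gcongr; omega
          _ = 2 ^ (441 * s + (3 + s)) := by rw [← pow_add, ← pow_add]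
          _ ≤ _ := Nat.pow_le_pow_right two_pos (by omega)
      have h3 : s * 2 ^ (24 * M) ≤ 2 ^ (448 * s) := by
        calc s * 2 ^ (24 * M) ≤ 2 ^ s * 2 ^ (24 * M) := by gcongr
          _ = 2 ^ (s + 24 * M) := by rw [← pow_add]
          _ ≤ _ := Nat.pow_le_pow_right two_pos (by omega)
      calc _ ≤ 2 ^ 2 * 2 ^ (448 * s) := by omega
        _ = 2 ^ (2 + 448 * s) := by rw [← pow_add]
        _ ≤ _ := Nat.pow_le_pow_right two_pos (by omega)

lemma isSignedSum_of_aNorm_le {M : ℕ} (hM : 1 ≤ M) {f : (Fin n → ZMod 2) → ℝ}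
    {z : (Fin n → ZMod 2) → ℤ} (hz : ∀ x, f x = z x) (hf : aNorm f ≤ M) :
    IsSignedSum (2 ^ 2 ^ (500 * M ^ 2)) z := by
  have hη : (0 : ℝ) < (1 / 4096) ^ M := by positivity
  have hηM : 8 * M * (1 / 4096 : ℝ) ^ M ≤ 1 := by
    rw [one_div, inv_pow, ← div_eq_mul_inv, div_le_one (by positivity)]
    have h : 8 * M ≤ 4096 ^ M := by
      calc 8 * M ≤ 8 ^ M * 2 ^ M :=
            Nat.mul_le_mul (Nat.le_self_pow (by omega) 8) Nat.lt_two_pow_self.le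
        _ = 16 ^ M := by rw [← mul_pow]; norm_num
        _ ≤ 4096 ^ M := Nat.pow_le_pow_left (by norm_num) M
    exact_mod_cast h
  have hD : (M : ℝ) ^ 2 ≤ ((1 / 4096) ^ M) ^ 2 * (M ^ 2 * 2 ^ (24 * M) : ℕ) := by
    have e : ((1 / 4096 : ℝ) ^ M) ^ 2 * 2 ^ (24 * M) = 1 := by
      rw [← pow_mul, mul_comm M 2, pow_mul, pow_mul, ← mul_pow]; norm_num
    push_cast
    refine le_of_eq ?_
    linear_combination -(M : ℝ) ^ 2 * e
  refine (isSignedSum_of_near hM hη hηM hD (2 * M) (ft f) z 0 le_rfl ?_ hf (fun x => ?_) ?_).mono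
    (length_bound hM)
  · push_cast
    rw [mul_div_cancel_left₀ _ two_ne_zero]
    exact hf
  · rw [walshSum_ft, hz, sub_self, abs_zero]
  · rw [zero_add, pow_mul, ← mul_pow]; norm_num

end

theorem main_theorem :
    ∃ C : ℝ, 0 < C ∧ ∀ (n : ℕ) (f : (Fin n → ZMod 2) → ℝ) (M : ℝ),
      (∀ x, f x = 0 ∨ f x = 1) → aNorm f ≤ M →
      ∃ (L : ℕ) (ε : Fin L → ℝ) (H : Fin L → Submodule (ZMod 2) (Fin n → ZMod 2)),
        (L : ℝ) ≤ (2 : ℝ) ^ ((2 : ℝ) ^ (C * M ^ 4)) ∧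
        (∀ j, ε j = 1 ∨ ε j = -1) ∧
        ∀ x, f x = ∑ j, ε j * (if x ∈ H j then (1 : ℝ) else 0) := by
  refine ⟨2000, by norm_num, fun n f M hf hM => ?_⟩
  rcases lt_or_ge M 1 with hM1 | hM1
  · refine ⟨0, Fin.elim0, Fin.elim0, ?_, fun j => j.elim0, fun x => ?_⟩
    · rw [Nat.cast_zero]; positivity
    · rw [univ_eq_empty, sum_empty]
      refine (hf x).resolve_right fun h => ?_
      have h1 := abs_walshSum_le (ft f) x
      rw [walshSum_ft, h, abs_one] at h1
      exact absurd (h1.trans hM) (not_le.2 hM1)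
  · set m := ⌈M⌉₊ with hm
    have hm1 : 1 ≤ m := Nat.one_le_ceil_iff.2 (by linarith)
    have hmM : (m : ℝ) ≤ 2 * M := by linarith [Nat.ceil_lt_add_one (by linarith : 0 ≤ M)]
    have hz : ∀ x, f x = ((if f x = 1 then 1 else 0 : ℤ) : ℝ) := fun x => by
      rcases hf x with h | h <;> simp [h]
    obtain ⟨s, hlen, hsign, hs⟩ := isSignedSum_of_aNorm_le hm1 hz (hM.trans (Nat.le_ceil M))
    refine ⟨s.length, fun j => ((s.get j).1 : ℝ), fun j => (s.get j).2, ?_, fun j => ?_,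
      fun x => ?_⟩
    · have h1 : (s.length : ℝ) ≤ (2 : ℝ) ^ ((2 : ℝ) ^ ((500 * m ^ 2 : ℕ) : ℝ)) := by
        have h2 : (2 : ℝ) ^ ((500 * m ^ 2 : ℕ) : ℝ) = ((2 ^ (500 * m ^ 2) : ℕ) : ℝ) := by
          rw [Real.rpow_natCast]; push_cast; rfl
        rw [h2, Real.rpow_natCast]
        exact_mod_cast hlen
      refine h1.trans (Real.rpow_le_rpow_of_exponent_le one_le_two
        (Real.rpow_le_rpow_of_exponent_le one_le_two ?_))
      push_cast
      have h3 : (m : ℝ) ^ 2 ≤ (2 * M) ^ 2 := pow_le_pow_left₀ (Nat.cast_nonneg m) hmM 2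
      have h4 : M ^ 2 ≤ M ^ 4 := pow_le_pow_right₀ hM1 (by norm_num)
      nlinarith
    · rcases hsign _ (List.get_mem s j) with h | h
      · left; simp only [h]; norm_num
      · right; simp only [h]; norm_num
    · have h1 := hs x
      simp only at h1
      rw [hz x, h1, ← Fin.sum_univ_fun_getElem]
      push_cast
      rfl
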